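/- arXiv:1909.11705 — 2 statements merged into one kernel-verified Lean document; each statement's English description precedes it below -/
import Mathlib

section
/- The vanishing ideal I(Y) of the subspace variety Y satisfies: (i) I(Y) contains no nonzero homogeneous polynomial of degree less than m; (ii) I(Y) is generated, as an ideal of R̄, by its homogeneous elements of degree m; and (iii) dim_ℂ I(Y)_m = binom(m·n(n+1)/2, m). -/
open MvPolynomial

/-- Index set for the variables `y_{(i,i'),(j,j')}` of `R̄`:
quadruples `((i,i'),(j,j'))` with `i ≤ i'` and `j ≤ j'`. -/
def PermIdx (m n : ℕ) : Type :=
  {w : (Fin m × Fin m) × (Fin n × Fin n) // w.1.1 ≤ w.1.2 ∧ w.2.1 ≤ w.2.2}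

/-- The subspace variety `Y`: symmetric tensors `T` (symmetric in the first two
and in the last two arguments) admitting a nonzero vector `v ∈ ℂ^m` with
`∑_i v_i T(i,i',j,j') = 0` for all `i', j, j'`. -/
def subspaceVariety (m n : ℕ) : Set (Fin m → Fin m → Fin n → Fin n → ℂ) :=
  {T | (∀ i i' j j', T i i' j j' = T i' i j j' ∧ T i i' j j' = T i i' j' j) ∧
    ∃ v : Fin m → ℂ, v ≠ 0 ∧ ∀ i' j j', ∑ i, v i * T i i' j j' = 0}

/-- The vanishing ideal `I(Y) ⊆ R̄` of the subspace variety, where a polynomial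
in the variables `y_{(i,i'),(j,j')}` is evaluated at `T` via
`y_{(i,i'),(j,j')}(T) = T(i,i',j,j')`. -/
noncomputable def vanishingIdeal (m n : ℕ) : Ideal (MvPolynomial (PermIdx m n) ℂ) :=
  ⨅ T ∈ subspaceVariety m n,
    RingHom.ker (eval fun w : PermIdx m n => T w.1.1.1 w.1.1.2 w.1.2.1 w.1.2.2)

set_option linter.unusedSectionVars false
set_option linter.unusedSimpArgs false
set_option linter.deprecated false

section Fischer
variable {ι : Type} [Fintype ι] [DecidableEq ι]

lemma pderiv_comm' (i j : ι) (f : MvPolynomial ι ℂ) :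
    pderiv i (pderiv j f) = pderiv j (pderiv i f) := by
  ext α
  simp only [coeff_pderiv]
  rw [add_right_comm α]
  by_cases h : i = j
  · subst h; ring
  · simp [Finsupp.single_apply, h, Ne.symm h]
    ring

/-- weighted derivative as an endomorphism -/
noncomputable def wD (wt : ι → ℕ) (i : ι) : Module.End ℂ (MvPolynomial ι ℂ) :=
  (wt i : ℂ) • (pderiv i : Derivation ℂ (MvPolynomial ι ℂ) (MvPolynomial ι ℂ)).toLinearMap

lemma wD_apply (wt : ι → ℕ) (i : ι) (f : MvPolynomial ι ℂ) :
    wD wt i f = (wt i : ℂ) • pderiv i f := rfl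

lemma wD_comm (wt : ι → ℕ) (i j : ι) : wD wt i * wD wt j = wD wt j * wD wt i := by
  refine LinearMap.ext fun f => ?_
  simp only [Module.End.mul_apply, wD_apply, Derivation.map_smul, pderiv_comm' i j]
  rw [smul_comm]

lemma exists_dop (wt : ι → ℕ) : ∃ φ : MvPolynomial ι ℂ →ₐ[ℂ] Module.End ℂ (MvPolynomial ι ℂ),
    ∀ i, φ (X i) = wD wt i := by
  have hc : ∀ a ∈ Set.range (wD wt), ∀ b ∈ Set.range (wD wt), a * b = b * a := by
    rintro _ ⟨i, rfl⟩ _ ⟨j, rfl⟩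
    exact wD_comm wt i j
  let _ : CommRing (Algebra.adjoin ℂ (Set.range (wD wt))) := Algebra.adjoinCommRingOfComm ℂ hc
  refine ⟨(Algebra.adjoin ℂ (Set.range (wD wt))).val.comp
    (aeval (fun i => (⟨wD wt i, Algebra.subset_adjoin ⟨i, rfl⟩⟩ :
      Algebra.adjoin ℂ (Set.range (wD wt))))), fun i => ?_⟩
  simp

/-- constant coefficient differential operators -/
noncomputable def Dop (wt : ι → ℕ) :
    MvPolynomial ι ℂ →ₐ[ℂ] Module.End ℂ (MvPolynomial ι ℂ) := (exists_dop wt).choose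

lemma Dop_X (wt : ι → ℕ) (i : ι) : Dop wt (X i) = wD wt i := (exists_dop wt).choose_spec i

lemma Dop_mul (wt : ι → ℕ) (p q f : MvPolynomial ι ℂ) :
    Dop wt (p * q) f = Dop wt p (Dop wt q f) := by
  rw [map_mul]; rfl

/-- weight of a monomial -/
def wgt (wt : ι → ℕ) (α : ι →₀ ℕ) : ℕ := ∏ i, wt i ^ α i * (α i).factorial

lemma wgt_add (wt : ι → ℕ) (α : ι →₀ ℕ) (i : ι) :
    wgt wt (α + Finsupp.single i 1) = wt i * (α i + 1) * wgt wt α := by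
  unfold wgt
  rw [← Finset.mul_prod_erase _ _ (Finset.mem_univ i), 
    ← Finset.mul_prod_erase Finset.univ (fun j => wt j ^ α j * _) (Finset.mem_univ i)]
  have : ∀ j ∈ Finset.univ.erase i, wt j ^ (α + Finsupp.single i 1 : ι →₀ ℕ) j *
     ((α + Finsupp.single i 1 : ι →₀ ℕ) j).factorial = wt j ^ α j * (α j).factorial := by
    intro j hj
    have : i ≠ j := (Finset.ne_of_mem_erase hj).symm
    simp [Finsupp.single_apply, this]
  rw [Finset.prod_congr rfl this]
  simp [Nat.factorial_succ, pow_succ]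
  ring

/-- Fischer bilinear form -/
noncomputable def FB (wt : ι → ℕ) : MvPolynomial ι ℂ →ₗ[ℂ] MvPolynomial ι ℂ →ₗ[ℂ] ℂ :=
  (basisMonomials ι ℂ).constr ℂ (fun α => (wgt wt α : ℂ) • lcoeff ℂ α)

lemma FB_monomial (wt : ι → ℕ) (α : ι →₀ ℕ) (g : MvPolynomial ι ℂ) :
    FB wt (monomial α 1) g = wgt wt α * coeff α g := by
  have := (basisMonomials ι ℂ).constr_basis ℂ (fun α => (wgt wt α : ℂ) • lcoeff ℂ α) α
  rw [coe_basisMonomials] at this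
  unfold FB
  rw [this]; simp

lemma FB_apply (wt : ι → ℕ) (f g : MvPolynomial ι ℂ) :
    FB wt f g = ∑ α ∈ f.support, wgt wt α * coeff α f * coeff α g := by
  conv_lhs => rw [← support_sum_monomial_coeff f]
  rw [map_sum, LinearMap.sum_apply]
  refine Finset.sum_congr rfl fun α _ => ?_
  have : monomial α (coeff α f) = coeff α f • monomial α (1:ℂ) := by simp [smul_monomial]
  rw [this, map_smul, LinearMap.smul_apply, FB_monomial, smul_eq_mul]
  ring

lemma FB_symm (wt : ι → ℕ) (f g : MvPolynomial ι ℂ) : FB wt f g = FB wt g f := by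
  classical
  have h1 : ∀ f g : MvPolynomial ι ℂ, FB wt f g = ∑ α ∈ f.support ∪ g.support, 
      wgt wt α * coeff α f * coeff α g := by
    intro f g
    rw [FB_apply]
    refine Finset.sum_subset Finset.subset_union_left ?_
    intro α _ h
    simp [notMem_support_iff.mp h]
  rw [h1 f g, h1 g f, Finset.union_comm]
  refine Finset.sum_congr rfl fun α _ => by ring

lemma FB_adj_X (wt : ι → ℕ) (i : ι) (f g : MvPolynomial ι ℂ) :
    FB wt (X i * f) g = FB wt f (wD wt i g) := by
  have : (FB wt).comp (LinearMap.mulLeft ℂ (X i)) = (FB wt).compl₂ (wD wt i) := by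
    refine (basisMonomials ι ℂ).ext fun α => ?_
    refine LinearMap.ext fun g => ?_
    simp only [coe_basisMonomials, LinearMap.comp_apply, LinearMap.mulLeft_apply,
      LinearMap.compl₂_apply]
    rw [mul_comm, X, monomial_mul, mul_one, FB_monomial, FB_monomial, wD_apply, coeff_smul,
      coeff_pderiv, wgt_add]
    push_cast
    simp only [smul_eq_mul]
    ring
  exact congrArg (fun L => L f g) this

lemma FB_adj (wt : ι → ℕ) (p f g : MvPolynomial ι ℂ) :
    FB wt (p * f) g = FB wt f (Dop wt p g) := by
  induction p using MvPolynomial.induction_on generalizing f g with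
  | C a =>
    rw [← MvPolynomial.algebraMap_eq, AlgHom.commutes]
    simp [Module.algebraMap_end_apply, ← MvPolynomial.smul_eq_C_mul]
  | add p q hp hq => simp [add_mul, hp, hq]
  | mul_X p i hp =>
    rw [mul_comm p, mul_assoc, FB_adj_X, hp, mul_comm (X i), Dop_mul, Dop_X]

/-- coefficientwise conjugation -/
noncomputable abbrev cj (f : MvPolynomial ι ℂ) : MvPolynomial ι ℂ := map (starRingEnd ℂ) f

lemma cj_Dop (wt : ι → ℕ) (p f : MvPolynomial ι ℂ) :
    cj (Dop wt p f) = Dop wt (cj p) (cj f) := by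
  induction p using MvPolynomial.induction_on generalizing f with
  | C a =>
    simp only [cj, map_C]
    rw [← MvPolynomial.algebraMap_eq, AlgHom.commutes, AlgHom.commutes]
    simp [Module.algebraMap_end_apply, MvPolynomial.smul_eq_C_mul]
  | add p q hp hq => simp only [cj, map_add, LinearMap.add_apply] at *; rw [hp, hq]
  | mul_X p i hp =>
    have h2 : cj (wD wt i f) = wD wt i (cj f) := by
      simp [cj, wD_apply, MvPolynomial.smul_eq_C_mul, pderiv_map]
    rw [Dop_mul, Dop_X, hp, h2]
    simp only [cj, map_mul, map_X]
    rw [Module.End.mul_apply, Dop_X]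

lemma wgt_pos (wt : ι → ℕ) (hw : ∀ i, 0 < wt i) (α : ι →₀ ℕ) : 0 < wgt wt α := by
  unfold wgt
  exact Finset.prod_pos fun i _ => Nat.mul_pos (pow_pos (hw i) _) (Nat.factorial_pos _)

lemma FB_self (wt : ι → ℕ) (f : MvPolynomial ι ℂ) :
    FB wt f (cj f) = ((∑ α ∈ f.support, wgt wt α * Complex.normSq (coeff α f) : ℝ) : ℂ) := by
  rw [FB_apply]
  push_cast
  refine Finset.sum_congr rfl fun α _ => ?_
  rw [coeff_map, mul_assoc, Complex.mul_conj]

lemma FB_self_re_nonneg (wt : ι → ℕ) (f : MvPolynomial ι ℂ) : 0 ≤ (FB wt f (cj f)).re := by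
  rw [FB_self, Complex.ofReal_re]
  exact Finset.sum_nonneg fun α _ => mul_nonneg (Nat.cast_nonneg _) (Complex.normSq_nonneg _)

lemma FB_def (wt : ι → ℕ) (hw : ∀ i, 0 < wt i) (f : MvPolynomial ι ℂ)
    (h : (FB wt f (cj f)).re = 0) : f = 0 := by
  rw [FB_self, Complex.ofReal_re, Finset.sum_eq_zero_iff_of_nonneg
    (fun α _ => mul_nonneg (Nat.cast_nonneg _) (Complex.normSq_nonneg _))] at h
  by_contra hf
  obtain ⟨α, hα⟩ := support_nonempty.mpr hf
  have := h α hα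
  have hp := wgt_pos wt hw α
  rw [mul_eq_zero] at this
  rcases this with h | h
  · simp at h; omega
  · rw [Complex.normSq_eq_zero] at h
    exact mem_support_iff.mp hα h

/-- positivity consequence -/
lemma capelli_inj {κ : Type} [Fintype κ] (wt : ι → ℕ) (hw : ∀ i, 0 < wt i)
    (p : κ → MvPolynomial ι ℂ) (hp : ∀ c, cj (p c) = p c) (f : MvPolynomial ι ℂ)
    (h : ∑ c, p c * Dop wt (p c) f = 0) (c : κ) : Dop wt (p c) f = 0 := by
  have h1 : ∑ c, FB wt (Dop wt (p c) f) (cj (Dop wt (p c) f)) = 0 := by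
    have := congrArg (fun g => FB wt g (cj f)) h
    simp only [map_sum, LinearMap.sum_apply, map_zero, LinearMap.zero_apply] at this
    rw [← this]
    refine Finset.sum_congr rfl fun c _ => ?_
    rw [FB_adj, cj_Dop, hp]
  have h2 := congrArg Complex.re h1
  rw [Complex.re_sum, Complex.zero_re, Finset.sum_eq_zero_iff_of_nonneg
    (fun c _ => FB_self_re_nonneg wt _)] at h2
  exact FB_def wt hw _ (h2 c (Finset.mem_univ c))

lemma omega_inj (wt : ι → ℕ) (hw : ∀ i, 0 < wt i)
    (p h : MvPolynomial ι ℂ) (hp : cj p = p) (h0 : Dop wt p (p * h) = 0) : p * h = 0 := by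
  apply FB_def wt hw
  rw [FB_symm]
  have : cj (p * h) = p * cj h := by
    simp only [cj, map_mul] at *; rw [hp]
  rw [this, FB_adj, h0]
  simp

end Fischer

section DetDvd

lemma degreeOf_det_le (m : ℕ) (x : Fin m × Fin m) :
    degreeOf x (Matrix.det (Matrix.mvPolynomialX (Fin m) (Fin m) ℂ)) ≤ 1 := by
  rw [Matrix.det_apply]
  refine (degreeOf_sum_le _ _ _).trans ?_
  refine Finset.sup_le fun σ _ => ?_
  have : degreeOf x (Equiv.Perm.sign σ • ∏ i, Matrix.mvPolynomialX (Fin m) (Fin m) ℂ (σ i) i)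
      = degreeOf x (∏ i, Matrix.mvPolynomialX (Fin m) (Fin m) ℂ (σ i) i) := by
    rcases Int.units_eq_one_or (Equiv.Perm.sign σ) with h | h <;> rw [h]
    · simp
    · simp [degreeOf_neg]
  rw [this]
  refine (degreeOf_prod_le _ _ _).trans ?_
  simp only [Matrix.mvPolynomialX_apply, degreeOf_X]
  calc _ ≤ ∑ i : Fin m, (if x.2 = i then 1 else 0) := by
        refine Finset.sum_le_sum fun i _ => ?_
        by_cases h : x = (σ i, i)
        · simp [h]
        · simp [h]
    _ ≤ 1 := by simp

lemma det_squarefree (m : ℕ) : Squarefree (Matrix.det (Matrix.mvPolynomialX (Fin m) (Fin m) ℂ)) := by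
  intro p hp
  obtain ⟨q, hq⟩ := hp
  have h0 := Matrix.det_mvPolynomialX_ne_zero (Fin m) ℂ
  have hpp : p ≠ 0 := by rintro rfl; simp at hq; exact h0 hq
  have hqq : q ≠ 0 := by rintro rfl; simp at hq; exact h0 hq
  have hd : ∀ x, degreeOf x p = 0 := by
    intro x
    have h1 := degreeOf_det_le m x
    rw [hq, degreeOf_mul_eq (mul_ne_zero hpp hpp) hqq, degreeOf_mul_eq hpp hpp] at h1
    omega
  have hv : p.vars = ∅ := by
    ext x
    have := hd x
    rw [degreeOf_def, Multiset.count_eq_zero] at this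
    simpa [vars_def] using this
  rw [vars_eq_empty_iff_eq_C] at hv
  rw [hv]
  refine (isUnit_iff_ne_zero.mpr ?_).map C
  intro h
  rw [h, map_zero] at hv
  exact hpp hv

lemma det_dvd (m : ℕ) (P : MvPolynomial (Fin m × Fin m) ℂ)
    (h : ∀ g : Matrix (Fin m) (Fin m) ℂ, g.det = 0 → eval (fun x => g x.1 x.2) P = 0) :
    Matrix.det (Matrix.mvPolynomialX (Fin m) (Fin m) ℂ) ∣ P := by
  set D := Matrix.det (Matrix.mvPolynomialX (Fin m) (Fin m) ℂ) with hD
  have h1 : P ∈ MvPolynomial.vanishingIdeal ℂ (zeroLocus ℂ (Ideal.span {D})) := by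
    rw [mem_vanishingIdeal_iff]
    intro x hx
    rw [mem_zeroLocus_iff] at hx
    have := hx D (Ideal.mem_span_singleton_self D)
    have h2 := h (Matrix.of fun i j => x (i, j)) (by
      rw [← this, hD, AlgHom.map_det]
      congr 1
      ext i j
      simp)
    simpa [aeval_eq_eval] using h2
  rw [vanishingIdeal_zeroLocus_eq_radical] at h1
  obtain ⟨k, hk⟩ := h1
  rw [Ideal.mem_span_singleton] at hk
  have hr : IsRadical D := (isRadical_iff_squarefree_of_ne_zero
    (Matrix.det_mvPolynomialX_ne_zero (Fin m) ℂ)).mpr (det_squarefree m)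
  exact hr k P hk

end DetDvd

section Chain
variable {m : ℕ} {W ι : Type} [Fintype W] [DecidableEq W] [Fintype ι] [DecidableEq ι]
  (E : Sym2 (Fin m) × W ≃ ι)

/-- the variable in row `i` and column `c` of the flattening -/
def yv (i : Fin m) (c : Fin m × W) : ι := E (s(i, c.1), c.2)

/-- weights: diagonal variables count twice -/
def swt (x : ι) : ℕ := if (E.symm x).1.IsDiag then 2 else 1

/-- maximal minors of the flattening -/
noncomputable def minorP (c : Fin m → Fin m × W) : MvPolynomial ι ℂ :=
  Matrix.det (Matrix.of fun i j => (X (yv E i (c j)) : MvPolynomial ι ℂ))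

/-- entries of `g T gᵗ` -/
noncomputable def qf (T : ι → ℂ) (x : ι) : MvPolynomial (Fin m × Fin m) ℂ :=
  Sym2.lift ⟨fun a b => ∑ k, ∑ l, C (T (E (s(k, l), (E.symm x).2))) * X (a, k) * X (b, l), by
    intro a b
    beta_reduce
    rw [Finset.sum_comm]
    refine Finset.sum_congr rfl fun k _ => Finset.sum_congr rfl fun l _ => ?_
    rw [Sym2.eq_swap]; ring⟩ (E.symm x).1

lemma qf_mk (T : ι → ℂ) (a b : Fin m) (w : W) : qf E T (E (s(a, b), w)) =
    ∑ k, ∑ l, C (T (E (s(k, l), w))) * X (a, k) * X (b, l) := by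
  simp [qf]

/-- entries of `T gᵗ` -/
noncomputable def aa (T : ι → ℂ) (j : Fin m) (c : Fin m × W) : MvPolynomial (Fin m × Fin m) ℂ :=
  ∑ l, C (T (E (s(j, l), c.2))) * X (c.1, l)

lemma pderiv_aa (T : ι → ℂ) (i j j' : Fin m) (c : Fin m × W) :
    pderiv (i, j) (aa E T j' c) = if c.1 = i then C (T (E (s(j', j), c.2))) else 0 := by
  simp only [aa, map_sum, pderiv_C_mul, pderiv_X, Pi.single_apply, Prod.mk.injEq]
  by_cases h : c.1 = i
  · simp [h, Prod.ext_iff]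
  · simp [h, Prod.ext_iff]

lemma pderiv_qf (T : ι → ℂ) (i j a b : Fin m) (w : W) :
    pderiv (i, j) (qf E T (E (s(a, b), w))) =
      (if a = i then aa E T j (b, w) else 0) + (if b = i then aa E T j (a, w) else 0) := by
  rw [qf_mk]
  simp only [map_sum, mul_assoc, pderiv_C_mul]
  simp only [pderiv_mul, pderiv_X, Pi.single_apply, mul_add,
    Finset.sum_add_distrib, aa]
  congr 1
  · by_cases h : a = i
    · simp [h, Prod.ext_iff, Finset.sum_ite_eq, ite_and]
    · simp [h, Prod.ext_iff]
  · by_cases h : b = i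
    · simp [h, Prod.ext_iff]
      refine Finset.sum_congr rfl fun k _ => ?_
      rw [Sym2.eq_swap]
    · simp [h, Prod.ext_iff]

lemma sum_wD_X (T : ι → ℂ) (i j a b : Fin m) (w : W) :
    ∑ c, aa E T j c * aeval (qf E T) (wD (swt E) (yv E i c) (X (E (s(a, b), w)))) =
      (if a = i then aa E T j (b, w) else 0) + (if b = i then aa E T j (a, w) else 0) := by
  have h1 : ∀ c : Fin m × W, aa E T j c *
      aeval (qf E T) (wD (swt E) (yv E i c) (X (E (s(a, b), w)))) =
      if c.2 = w then (if s(i, c.1) = s(a, b) then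
        (if a = b then 2 else 1) * aa E T j (c.1, w) else 0) else 0 := by
    rintro ⟨k, w'⟩
    simp only [wD_apply, yv, pderiv_X, Pi.single_apply, E.injective.eq_iff, Prod.mk.injEq]
    by_cases hw : w' = w
    · subst hw
      by_cases hs : s(i, k) = s(a, b)
      · simp only [hs, swt, E.symm_apply_apply, Sym2.isDiag_iff_proj_eq]
        by_cases hab : a = b
        · simp [hab, MvPolynomial.smul_eq_C_mul, mul_comm]
          rw [mul_comm]; congr 1
        · simp [hab]
      · simp [hs, Ne.symm hs]
    · have : w ≠ w' := fun h => hw h.symm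
      simp [hw, this]
  rw [Finset.sum_congr rfl fun c _ => h1 c, Fintype.sum_prod_type]
  simp only [Finset.sum_ite_eq', Finset.mem_univ, if_true, Finset.sum_ite_irrel,
    Finset.sum_const_zero, Sym2.eq_iff]
  by_cases hab : a = b
  · subst hab
    by_cases hi : a = i
    · subst hi; simp; ring
    · simp [hi, Ne.symm hi]
  · by_cases hi : a = i
    · subst hi
      have : ¬ b = a := fun h => hab h.symm
      simp [hab, this]
    · by_cases hb : b = i
      · subst hb
        have : ¬ b = a := fun h => hab h.symm
        simp [hab, this]
      · have h1 : ¬ i = a := fun h => hi h.symm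
        have h2 : ¬ i = b := fun h => hb h.symm
        simp [hi, hb, h1, h2]

lemma pderiv_phi (T : ι → ℂ) (i j : Fin m) (F : MvPolynomial ι ℂ) :
    pderiv (i, j) (aeval (qf E T) F) =
      ∑ c, aa E T j c * aeval (qf E T) (wD (swt E) (yv E i c) F) := by
  induction F using MvPolynomial.induction_on with
  | C a => simp [wD_apply]
  | add p q hp hq => simp only [map_add, hp, hq, mul_add, Finset.sum_add_distrib]
  | mul_X p x hp =>
    have hx : pderiv (i, j) (aeval (qf E T) (X x : MvPolynomial ι ℂ)) =
      ∑ c, aa E T j c * aeval (qf E T) (wD (swt E) (yv E i c) (X x)) := by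
      obtain ⟨⟨s, w⟩, rfl⟩ := E.surjective x
      induction s using Sym2.ind with
      | _ a b => rw [sum_wD_X, aeval_X, pderiv_qf]
    rw [map_mul, pderiv_mul, hx, hp, Finset.sum_mul, Finset.mul_sum, ← Finset.sum_add_distrib]
    refine Finset.sum_congr rfl fun c _ => ?_
    simp only [wD_apply, pderiv_mul, smul_add, map_add, map_mul, MvPolynomial.smul_eq_C_mul]
    ring

lemma pderiv_prod_mul {κ τ : Type} [DecidableEq κ] (x : τ) (S : Finset κ) (u : κ → MvPolynomial τ ℂ)
    (v : MvPolynomial τ ℂ) : pderiv x ((∏ i ∈ S, u i) * v) = (∏ i ∈ S, u i) * pderiv x v +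
      ∑ s ∈ S, pderiv x (u s) * ((∏ i ∈ S.erase s, u i) * v) := by
  induction S using Finset.induction_on generalizing v with
  | empty => simp
  | insert r S hr ih =>
    rw [Finset.prod_insert hr, mul_comm (u r), mul_assoc, ih, Finset.sum_insert hr,
      Finset.erase_insert hr, pderiv_mul]
    have : ∑ s ∈ S, pderiv x (u s) * ((∏ i ∈ (insert r S).erase s, u i) * v) =
       ∑ s ∈ S, pderiv x (u s) * ((∏ i ∈ S.erase s, u i) * (u r * v)) := by
      refine Finset.sum_congr rfl fun s hs => ?_
      have hne : r ≠ s := fun h => hr (h ▸ hs)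
      rw [Finset.erase_insert_of_ne hne, Finset.prod_insert (fun h => hr (Finset.mem_of_mem_erase h))]
      ring
    rw [this]
    ring

/-- the partially expanded Omega process -/
noncomputable def HH (T : ι → ℂ) (S : Finset (Fin m)) (c : Fin m → Fin m × W)
    (F : MvPolynomial ι ℂ) : MvPolynomial (Fin m × Fin m) ℂ :=
  ∑ σ : Equiv.Perm (Fin m), ((Equiv.Perm.sign σ : ℤ) : ℂ) •
    Dop (fun _ => 1) (∏ i ∈ Sᶜ, X (i, σ i))
      ((∏ i ∈ S, aa E T (σ i) (c i)) * aeval (qf E T) F)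

lemma HH_cross (T : ι → ℂ) (S : Finset (Fin m)) (c : Fin m → Fin m × W)
    (F : MvPolynomial ι ℂ) (r : Fin m) (hr : r ∉ S) (s : Fin m) (hs : s ∈ S) :
    ∑ σ : Equiv.Perm (Fin m), ((Equiv.Perm.sign σ : ℤ) : ℂ) •
    Dop (fun _ => 1) (∏ i ∈ (insert r S)ᶜ, X (i, σ i))
      (pderiv (r, σ r) (aa E T (σ s) (c s)) *
        ((∏ i ∈ S.erase s, aa E T (σ i) (c i)) * aeval (qf E T) F)) = 0 := by
  have hne : r ≠ s := fun h => hr (h ▸ hs)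
  refine Finset.sum_involution (fun σ _ => σ * Equiv.swap r s) ?_ ?_ (fun _ _ => Finset.mem_univ _) ?_
  · intro σ _
    have h1 : ∏ i ∈ (insert r S)ᶜ, (X (i, (σ * Equiv.swap r s) i) : MvPolynomial (Fin m × Fin m) ℂ)
        = ∏ i ∈ (insert r S)ᶜ, X (i, σ i) := by
      refine Finset.prod_congr rfl fun i hi => ?_
      simp only [Finset.mem_compl, Finset.mem_insert, not_or] at hi
      rw [Equiv.Perm.mul_apply, Equiv.swap_apply_of_ne_of_ne hi.1 (fun h : i = s => hi.2 (h ▸ hs))]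
    have h2 : ∏ i ∈ S.erase s, aa E T ((σ * Equiv.swap r s) i) (c i)
        = ∏ i ∈ S.erase s, aa E T (σ i) (c i) := by
      refine Finset.prod_congr rfl fun i hi => ?_
      simp only [Finset.mem_erase] at hi
      rw [Equiv.Perm.mul_apply, Equiv.swap_apply_of_ne_of_ne (fun h : i = r => hr (h ▸ hi.2)) hi.1]
    rw [h1, h2]
    simp only [pderiv_aa, Equiv.Perm.mul_apply, Equiv.swap_apply_left, Equiv.swap_apply_right,
      Equiv.Perm.sign_mul, Equiv.Perm.sign_swap hne]
    rw [Sym2.eq_swap]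
    simp
  · intro σ _ _ h
    have := congrArg (fun τ : Equiv.Perm (Fin m) => τ r) h
    simp at this
    exact hne this.symm
  · intro σ _
    simp [mul_assoc]

lemma HH_step (T : ι → ℂ) (S : Finset (Fin m)) (c : Fin m → Fin m × W)
    (F : MvPolynomial ι ℂ) (r : Fin m) (hr : r ∉ S) :
    HH E T S c F = ∑ k, HH E T (insert r S) (Function.update c r k) (wD (swt E) (yv E r k) F) := by
  have h1 : Sᶜ = insert r (insert r S)ᶜ := by
    ext i; simp only [Finset.mem_compl, Finset.mem_insert, not_or]
    by_cases h : i = r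
    · simp [h, hr]
    · simp [h]
  have h2 : ∀ σ : Equiv.Perm (Fin m), Dop (fun _ => 1) (∏ i ∈ Sᶜ, X (i, σ i))
      ((∏ i ∈ S, aa E T (σ i) (c i)) * aeval (qf E T) F) =
      ∑ k, Dop (fun _ => 1) (∏ i ∈ (insert r S)ᶜ, X (i, σ i))
        ((∏ i ∈ insert r S, aa E T (σ i) (Function.update c r k i)) *
          aeval (qf E T) (wD (swt E) (yv E r k) F)) +
      ∑ s ∈ S, Dop (fun _ => 1) (∏ i ∈ (insert r S)ᶜ, X (i, σ i))
      (pderiv (r, σ r) (aa E T (σ s) (c s)) *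
        ((∏ i ∈ S.erase s, aa E T (σ i) (c i)) * aeval (qf E T) F)) := by
    intro σ
    rw [h1, Finset.prod_insert (by simp), mul_comm, Dop_mul, Dop_X, wD_apply, Nat.cast_one,
      one_smul, pderiv_prod_mul, map_add, pderiv_phi, Finset.mul_sum]
    rw [map_sum, map_sum]
    refine congrArg₂ (· + ·) (Finset.sum_congr rfl fun k _ => congrArg _ ?_) rfl
    rw [Finset.prod_insert hr, Function.update_self]
    have : ∏ i ∈ S, aa E T (σ i) (Function.update c r k i) = ∏ i ∈ S, aa E T (σ i) (c i) := by
      refine Finset.prod_congr rfl fun i hi => ?_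
      rw [Function.update_of_ne (fun h : i = r => hr (h ▸ hi))]
    rw [this]
    ring
  unfold HH
  simp only [h2, smul_add, Finset.sum_add_distrib, Finset.smul_sum]
  rw [Finset.sum_comm, add_eq_left, Finset.sum_comm]
  exact Finset.sum_eq_zero fun s hs => HH_cross E T S c F r hr s hs

/-- summing over all columns -/
noncomputable def UU (T : ι → ℂ) (F : MvPolynomial ι ℂ) (S : Finset (Fin m)) :
    MvPolynomial (Fin m × Fin m) ℂ :=
  ∑ c : Fin m → Fin m × W, HH E T S c (Dop (swt E) (∏ i ∈ S, X (yv E i (c i))) F)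

lemma sum_update {A M : Type} [Fintype A] [DecidableEq A] [AddCommMonoid M] (r : Fin m)
    (f : (Fin m → A) → M) : ∑ c, ∑ k, f (Function.update c r k) = Fintype.card A • ∑ c, f c := by
  have : ∑ c, ∑ k, f (Function.update c r k) = ∑ p : (Fin m → A) × A, f p.1 := by
    rw [← Fintype.sum_prod_type']
    refine Finset.sum_bij' (fun p _ => (Function.update p.1 r p.2, p.1 r))
      (fun p _ => (Function.update p.1 r p.2, p.1 r)) ?_ ?_ ?_ ?_ ?_ <;> simp
  rw [this, Fintype.sum_prod_type, Finset.smul_sum]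
  simp

lemma UU_step (T : ι → ℂ) (F : MvPolynomial ι ℂ) (S : Finset (Fin m)) (r : Fin m) (hr : r ∉ S) :
    UU E T F S = Fintype.card (Fin m × W) • UU E T F (insert r S) := by
  unfold UU
  rw [← sum_update r]
  refine Finset.sum_congr rfl fun c _ => ?_
  rw [HH_step E T S c _ r hr]
  refine Finset.sum_congr rfl fun k _ => ?_
  congr 1
  rw [Finset.prod_insert hr, Dop_mul, Dop_X, Function.update_self]
  congr 3
  refine Finset.prod_congr rfl fun i hi => ?_
  rw [Function.update_of_ne (fun h : i = r => hr (h ▸ hi))]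

lemma UU_zero (T : ι → ℂ) (F : MvPolynomial ι ℂ) (h : UU E T F Finset.univ = 0)
    (S : Finset (Fin m)) : UU E T F S = 0 := by
  have : ∀ S : Finset (Fin m), UU E T F Sᶜ = 0 := by
    intro S
    induction S using Finset.induction_on with
    | empty => simpa using h
    | insert r S hr ih =>
      rw [UU_step E T F _ r (by simp)]
      have : insert r (insert r S)ᶜ = Sᶜ := by
        ext i; simp only [Finset.mem_compl, Finset.mem_insert, not_or]
        by_cases h : i = r
        · simp [h, hr]
        · simp [h]
      rw [this, ih, smul_zero]
  simpa using this Sᶜ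

lemma UU_univ (T : ι → ℂ) (F : MvPolynomial ι ℂ)
    (hF : ∀ c, Dop (swt E) (minorP E c) F = 0) : UU E T F Finset.univ = 0 := by
  let t : (Fin m → Fin m × W) → MvPolynomial (Fin m × Fin m) ℂ := fun c =>
    Matrix.det (Matrix.of fun j i => aa E T j (c i)) *
      aeval (qf E T) (Dop (swt E) (∏ i, X (yv E i (c i))) F)
  have h1 : UU E T F Finset.univ = ∑ c, t c := by
    unfold UU
    refine Finset.sum_congr rfl fun c _ => ?_
    simp only [HH, t, Matrix.det_apply', Finset.sum_mul, Matrix.of_apply]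
    refine Finset.sum_congr rfl fun σ _ => ?_
    simp [MvPolynomial.smul_eq_C_mul, mul_assoc]
  have h2 : ∀ c, ∑ τ : Equiv.Perm (Fin m), t (c ∘ τ) = 0 := by
    intro c
    have h3 : ∀ τ : Equiv.Perm (Fin m), t (c ∘ τ) = Matrix.det (Matrix.of fun j i => aa E T j (c i)) *
      aeval (qf E T) (Dop (swt E) (((Equiv.Perm.sign τ : ℤ) : MvPolynomial ι ℂ) *
        ∏ i, X (yv E i (c (τ i)))) F) := by
      intro τ
      have := Matrix.det_permute' τ (Matrix.of fun j i => aa E T j (c i))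
      simp only [t]
      have e : (Matrix.of fun j i => aa E T j ((c ∘ τ) i)) =
        (Matrix.of fun j i => aa E T j (c i)).submatrix id τ := rfl
      rw [e, this, Dop_mul, map_intCast (Dop (swt E))]
      simp only [Module.End.intCast_apply, map_zsmul, Function.comp]
      rw [zsmul_eq_mul]
      ring
    simp only [h3, ← Finset.mul_sum, ← map_sum, ← LinearMap.sum_apply]
    have h4 : ∑ τ : Equiv.Perm (Fin m), (((Equiv.Perm.sign τ : ℤ) : MvPolynomial ι ℂ) *
        ∏ i, X (yv E i (c (τ i)))) = minorP E c := by
      rw [minorP, ← Matrix.det_transpose, Matrix.det_apply']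
      rfl
    rw [h4, hF]
    simp
  have h5 : ∑ τ : Equiv.Perm (Fin m), ∑ c, t c = 0 := by
    have h6 : ∀ τ : Equiv.Perm (Fin m), ∑ c, t c = ∑ c, t (c ∘ τ) := fun τ =>
      (Equiv.sum_comp (Equiv.arrowCongr τ.symm (Equiv.refl (Fin m × W))) t).symm
    rw [Finset.sum_congr rfl fun τ _ => h6 τ, Finset.sum_comm]
    exact Finset.sum_eq_zero fun c _ => h2 c
  rw [h1]
  rw [Finset.sum_const, smul_eq_zero] at h5
  refine h5.resolve_left ?_
  simp [Fintype.card_perm, Nat.factorial_ne_zero]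

lemma omega_zero [Nonempty (Fin m × W)] (T : ι → ℂ) (F : MvPolynomial ι ℂ)
    (hF : ∀ c, Dop (swt E) (minorP E c) F = 0) :
    Dop (fun _ => 1) (Matrix.det (Matrix.mvPolynomialX (Fin m) (Fin m) ℂ)) (aeval (qf E T) F) = 0 := by
  have h := UU_zero E T F (UU_univ E T F hF) ∅
  have h1 : ∀ c, HH E T ∅ c F = Dop (fun _ => 1)
      (Matrix.det (Matrix.mvPolynomialX (Fin m) (Fin m) ℂ)) (aeval (qf E T) F) := by
    intro c
    rw [← Matrix.det_transpose, Matrix.det_apply', map_sum, LinearMap.sum_apply]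
    unfold HH
    refine Finset.sum_congr rfl fun σ _ => ?_
    rw [Dop_mul, map_intCast (Dop (fun _ : Fin m × Fin m => 1))]
    simp [Module.End.intCast_apply, ← Int.cast_smul_eq_zsmul ℂ]
  simp only [UU, Finset.prod_empty, map_one, Module.End.one_apply, h1, Finset.sum_const] at h
  rw [smul_eq_zero] at h
  exact h.resolve_left (Finset.card_ne_zero.mpr Finset.univ_nonempty)

end Chain

section Degree
variable {ι : Type} [Fintype ι] [DecidableEq ι]

/-- polynomials of degree at most `d - k` (zero if `k > d`) -/
def Lsub (ι : Type) (k d : ℕ) : Submodule ℂ (MvPolynomial ι ℂ) where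
  carrier := {G | ∀ α, coeff α G ≠ 0 → α.degree + k ≤ d}
  zero_mem' := by intro α h; simp at h
  add_mem' := by
    intro a b ha hb α h
    rw [coeff_add] at h
    by_cases h1 : coeff α a = 0
    · exact hb α (by intro h2; exact h (by rw [h1, h2, add_zero]))
    · exact ha α h1
  smul_mem' := by
    intro r a ha α h
    rw [coeff_smul, smul_eq_mul] at h
    exact ha α (right_ne_zero_of_mul h)

lemma Lsub_wD (wt : ι → ℕ) (k d : ℕ) (i : ι) (G : MvPolynomial ι ℂ) (h : G ∈ Lsub ι k d) :
    wD wt i G ∈ Lsub ι (k + 1) d := by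
  rw [wD_apply]
  refine Submodule.smul_mem _ _ ?_
  intro α hα
  rw [coeff_pderiv] at hα
  have := h _ (left_ne_zero_of_mul hα)
  rw [map_add, Finsupp.degree_single] at this
  omega

lemma Lsub_X (k d : ℕ) (i : ι) (G : MvPolynomial ι ℂ) (h : G ∈ Lsub ι (k + 1) d) :
    X i * G ∈ Lsub ι k d := by
  intro α hα
  rw [coeff_X_mul'] at hα
  split_ifs at hα with hi
  · have := h _ hα
    have h2 : α = (α - Finsupp.single i 1) + Finsupp.single i 1 := by
      rw [tsub_add_cancel_of_le]
      rw [Finsupp.single_le_iff]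
      exact Nat.one_le_iff_ne_zero.mpr (Finsupp.mem_support_iff.mp hi)
    rw [h2, map_add, Finsupp.degree_single]
    omega
  · exact absurd rfl hα

lemma Lsub_Dop_prod {κ : Type} [DecidableEq κ] (wt : ι → ℕ) (d : ℕ) (S : Finset κ) (u : κ → ι)
    (G : MvPolynomial ι ℂ) (h : G ∈ Lsub ι 0 d) :
    Dop wt (∏ s ∈ S, X (u s)) G ∈ Lsub ι S.card d := by
  induction S using Finset.induction_on with
  | empty => simpa using h
  | insert r S hr ih =>
    rw [Finset.prod_insert hr, Dop_mul, Dop_X, Finset.card_insert_of_notMem hr]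
    exact Lsub_wD _ _ _ _ _ ih

lemma Lsub_mul_prod {κ : Type} [DecidableEq κ] (d : ℕ) (S : Finset κ) (u : κ → ι)
    (k : ℕ) (G : MvPolynomial ι ℂ) (h : G ∈ Lsub ι (k + S.card) d) :
    (∏ s ∈ S, X (u s)) * G ∈ Lsub ι k d := by
  induction S using Finset.induction_on generalizing k with
  | empty => simpa using h
  | insert r S hr ih =>
    rw [Finset.prod_insert hr, mul_assoc]
    refine Lsub_X _ _ _ _ (ih _ ?_)
    rw [Finset.card_insert_of_notMem hr] at h
    rwa [add_right_comm, add_assoc]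

lemma Lsub_of_homog (d : ℕ) (G : MvPolynomial ι ℂ) (h : G.IsHomogeneous d) : G ∈ Lsub ι 0 d := by
  intro α hα
  have := h hα
  have h2 : α.degree = Finsupp.weight 1 α := by
    rw [Finsupp.degree_eq_weight_one]; rfl
  rw [h2, this, add_zero]

lemma Lsub_total (G : MvPolynomial ι ℂ) : G ∈ Lsub ι 0 G.totalDegree := by
  intro α hα
  exact le_totalDegree (mem_support_iff.mpr hα)

lemma Lsub_le (d : ℕ) : Lsub ι 0 d ≤ restrictTotalDegree ι ℂ d := by
  intro G hG
  rw [mem_restrictTotalDegree]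
  exact Finset.sup_le fun α hα => hG α (mem_support_iff.mp hα)

instance (d : ℕ) : Module.Finite ℂ (Lsub ι 0 d) :=
  Submodule.finiteDimensional_of_le (Lsub_le d)

lemma Lsub_lt (k d : ℕ) (hkd : d < k) (G : MvPolynomial ι ℂ) (h : G ∈ Lsub ι k d) : G = 0 := by
  ext α
  by_contra hα
  have := h α hα
  omega

lemma Lsub_eq (d : ℕ) (G : MvPolynomial ι ℂ) (h : G ∈ Lsub ι d d) : G = C (coeff 0 G) := by
  ext α
  rw [coeff_C]
  split_ifs with h0
  · rw [h0]
  · by_contra hα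
    have := h α hα
    have h2 : α.degree = 0 := by omega
    rw [Finsupp.degree_eq_zero_iff] at h2
    exact h0 h2.symm

end Degree

section Main
variable {m : ℕ} {W ι : Type} [Fintype W] [DecidableEq W] [Fintype ι] [DecidableEq ι]
  (E : Sym2 (Fin m) × W ≃ ι)

lemma minorP_eq (c : Fin m → Fin m × W) : minorP E c = 
    ∑ σ : Equiv.Perm (Fin m), ((Equiv.Perm.sign σ : ℤ) : ℂ) • ∏ i, X (yv E (σ i) (c i)) := by
  rw [minorP, Matrix.det_apply']
  refine Finset.sum_congr rfl fun σ _ => ?_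
  rw [MvPolynomial.smul_eq_C_mul]
  simp

lemma cj_minorP (c : Fin m → Fin m × W) : cj (minorP E c) = minorP E c := by
  simp only [cj, minorP]
  rw [RingHom.map_det]
  congr 1
  ext1 i j
  simp

lemma Lsub_Dop_minor (c : Fin m → Fin m × W) (wt : ι → ℕ) (d : ℕ) (G : MvPolynomial ι ℂ)
    (h : G ∈ Lsub ι 0 d) : Dop wt (minorP E c) G ∈ Lsub ι m d := by
  rw [minorP_eq, map_sum, LinearMap.sum_apply]
  refine Submodule.sum_mem _ fun σ _ => ?_
  rw [map_smul, LinearMap.smul_apply]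
  refine Submodule.smul_mem _ _ ?_
  simpa using Lsub_Dop_prod wt d Finset.univ (fun i => yv E (σ i) (c i)) G h

lemma Lsub_mul_minor (c : Fin m → Fin m × W) (d : ℕ) (G : MvPolynomial ι ℂ)
    (h : G ∈ Lsub ι m d) : minorP E c * G ∈ Lsub ι 0 d := by
  rw [minorP_eq, Finset.sum_mul]
  refine Submodule.sum_mem _ fun σ _ => ?_
  rw [smul_mul_assoc]
  refine Submodule.smul_mem _ _ ?_
  exact Lsub_mul_prod d Finset.univ (fun i => yv E (σ i) (c i)) 0 G (by simpa using h)

/-- tensors with a kernel vector -/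
def Ysub : Set (ι → ℂ) :=
  {T | ∃ v : Fin m → ℂ, v ≠ 0 ∧ ∀ k w, ∑ i, v i * T (E (s(i, k), w)) = 0}

/-- vanishing ideal -/
def vI : Ideal (MvPolynomial ι ℂ) where
  carrier := {f | ∀ T ∈ Ysub E, eval T f = 0}
  zero_mem' := by intro T _; simp
  add_mem' := by intro a b ha hb T hT; simp [ha T hT, hb T hT]
  smul_mem' := by intro r a ha T hT; simp [ha T hT]

lemma mem_vI (f : MvPolynomial ι ℂ) : f ∈ vI E ↔ ∀ T ∈ Ysub E, eval T f = 0 := Iff.rfl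

lemma minor_mem (c : Fin m → Fin m × W) : minorP E c ∈ vI E := by
  rintro T ⟨v, hv, h⟩
  rw [minorP, RingHom.map_det]
  refine Matrix.exists_vecMul_eq_zero_iff.mp ⟨v, hv, ?_⟩
  ext j
  simpa [Matrix.vecMul, dotProduct, yv] using h (c j).1 (c j).2

lemma key [Nonempty (Fin m × W)] (F : MvPolynomial ι ℂ) (hF : F ∈ vI E)
    (h : ∀ c, Dop (swt E) (minorP E c) F = 0) : F = 0 := by
  refine MvPolynomial.funext fun T => ?_
  rw [map_zero]
  set P := aeval (qf E T) F with hP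
  have hev : ∀ g : Matrix (Fin m) (Fin m) ℂ, eval (fun x => g x.1 x.2) P =
      eval (fun x => eval (fun y : Fin m × Fin m => g y.1 y.2) (qf E T x)) F := by
    intro g
    rw [hP, aeval_def, eval₂_eq', map_sum, eval_eq']
    refine Finset.sum_congr rfl fun α _ => ?_
    simp [MvPolynomial.algebraMap_eq]
  obtain ⟨q, hq⟩ := det_dvd m P (by
    intro g hg
    rw [hev]
    apply hF
    obtain ⟨v, hv, hvg⟩ := Matrix.exists_vecMul_eq_zero_iff.mpr hg
    refine ⟨v, hv, fun b w => ?_⟩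
    have h1 : ∀ k, ∑ a, v a * g a k = 0 := fun k => by
      simpa [Matrix.vecMul, dotProduct] using congrFun hvg k
    simp only [qf_mk, map_sum, map_mul, eval_C, eval_X, Finset.mul_sum]
    rw [Finset.sum_comm]
    refine Finset.sum_eq_zero fun k _ => ?_
    rw [Finset.sum_comm]
    refine Finset.sum_eq_zero fun l _ => ?_
    calc _ = (∑ a, v a * g a k) * (T (E (s(k, l), w)) * g b l) := by
          rw [Finset.sum_mul]
          exact Finset.sum_congr rfl fun a _ => by ring
      _ = 0 := by rw [h1, zero_mul])
  have h0 := omega_zero E T F h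
  rw [← hP, hq] at h0
  have hz := omega_inj _ (fun _ => Nat.one_pos) _ q (by
    simp only [cj]
    rw [RingHom.map_det]
    congr 1
    ext1 i j
    simp) h0
  rw [← hq] at hz
  have := hev 1
  rw [hz, map_zero] at this
  rw [this]
  congr 2
  funext x
  obtain ⟨⟨s, w⟩, rfl⟩ := E.surjective x
  induction s using Sym2.ind with
  | _ a b => simp [qf_mk, Matrix.one_apply]

/-- the Capelli-type operator -/
noncomputable def Cap : Module.End ℂ (MvPolynomial ι ℂ) :=
  ∑ c, (LinearMap.mulLeft ℂ (minorP E c)).comp (Dop (swt E) (minorP E c))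

lemma Cap_apply (F : MvPolynomial ι ℂ) :
    Cap E F = ∑ c, minorP E c * Dop (swt E) (minorP E c) F := by
  simp [Cap]

lemma swt_pos (x : ι) : 0 < swt E x := by
  unfold swt; split_ifs <;> simp

lemma Cap_surj [Nonempty (Fin m × W)] (d : ℕ) (F : MvPolynomial ι ℂ) (hF : F ∈ vI E)
    (hd : F ∈ Lsub ι 0 d) : ∃ G ∈ Lsub ι 0 d, Cap E G = F := by
  let V : Submodule ℂ (MvPolynomial ι ℂ) := Submodule.restrictScalars ℂ (vI E) ⊓ Lsub ι 0 d
  have hV : ∀ G ∈ V, Cap E G ∈ V := by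
    rintro G ⟨h1, h2⟩
    rw [Cap_apply]
    refine Submodule.sum_mem _ fun c _ => ⟨?_, ?_⟩
    · exact Ideal.mul_mem_right _ _ (minor_mem E c)
    · exact Lsub_mul_minor E c d _ (Lsub_Dop_minor E c _ d G h2)
  have : FiniteDimensional ℂ V := Submodule.finiteDimensional_of_le (inf_le_right : V ≤ Lsub ι 0 d)
  let L : V →ₗ[ℂ] V := (Cap E).restrict hV
  have hinj : Function.Injective L := by
    rw [injective_iff_map_eq_zero]
    rintro ⟨G, hG⟩ h0
    have h1 : Cap E G = 0 := congrArg Subtype.val h0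
    rw [Cap_apply] at h1
    have := capelli_inj (swt E) (swt_pos E) (minorP E) (cj_minorP E) G h1
    exact Subtype.ext (key E G hG.1 this)
  obtain ⟨⟨G, hG⟩, h⟩ := LinearMap.injective_iff_surjective.mp hinj ⟨F, hF, hd⟩
  exact ⟨G, hG.2, congrArg Subtype.val h⟩

lemma part_i [Nonempty (Fin m × W)] (F : MvPolynomial ι ℂ) (hF : F ∈ vI E) (d : ℕ) (hd : d < m)
    (h : F.IsHomogeneous d) : F = 0 :=
  key E F hF fun c => Lsub_lt m d hd _ (Lsub_Dop_minor E c _ d F (Lsub_of_homog d F h))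

lemma minor_homog (c : Fin m → Fin m × W) : (minorP E c).IsHomogeneous m := by
  rw [minorP_eq]
  refine IsHomogeneous.sum _ _ _ fun σ _ => ?_
  rw [MvPolynomial.smul_eq_C_mul]
  refine IsHomogeneous.C_mul ?_ _
  simpa using IsHomogeneous.prod Finset.univ (fun i => (X (yv E (σ i) (c i)) : MvPolynomial ι ℂ))
    (fun _ => 1) (fun i _ => isHomogeneous_X _ _)

lemma part_ii [Nonempty (Fin m × W)] :
    vI E = Ideal.span {f | f ∈ vI E ∧ f.IsHomogeneous m} := by
  refine le_antisymm ?_ (Ideal.span_le.mpr fun f hf => hf.1)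
  intro F hF
  obtain ⟨G, _, rfl⟩ := Cap_surj E _ F hF (Lsub_total F)
  rw [Cap_apply]
  exact Ideal.sum_mem _ fun c _ => Ideal.mul_mem_right _ _
    (Ideal.subset_span ⟨minor_mem E c, minor_homog E c⟩)

lemma deg_m_eq [Nonempty (Fin m × W)] :
    Submodule.restrictScalars ℂ (vI E) ⊓ homogeneousSubmodule ι ℂ m =
      Submodule.span ℂ (Set.range (minorP E)) := by
  refine le_antisymm ?_ ?_
  · rintro F ⟨hF, hm⟩
    obtain ⟨G, hG, rfl⟩ := Cap_surj E m F hF (Lsub_of_homog m F hm)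
    rw [Cap_apply]
    refine Submodule.sum_mem _ fun c _ => ?_
    rw [Lsub_eq m _ (Lsub_Dop_minor E c _ m G hG), mul_comm, ← MvPolynomial.smul_eq_C_mul]
    exact Submodule.smul_mem _ _ (Submodule.subset_span ⟨c, rfl⟩)
  · rw [Submodule.span_le]
    rintro _ ⟨c, rfl⟩
    exact ⟨minor_mem E c, minor_homog E c⟩

lemma exists_good (c : Fin m → Fin m × W) : ∃ σ : Equiv.Perm (Fin m),
    ∀ i, ∃ i0, (c i0).1 = (c i).1 ∧ σ i0 = (c i).1 := by
  classical
  obtain ⟨s, -, hs⟩ := (Set.surjOn_image (fun i => (c i).1) Set.univ).exists_bijOn_subset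
  obtain ⟨g, hg⟩ := Set.MapsTo.exists_equiv_extend_of_card_eq (t := (Finset.univ : Finset (Fin m)))
    (s := s) (f := fun i => (c i).1) (by simp) (by intro i _; simp) hs.injOn
  refine ⟨g.trans (Equiv.subtypeUnivEquiv (by simp)), fun i => ?_⟩
  obtain ⟨i0, hi0, h⟩ := hs.surjOn ⟨i, Set.mem_univ i, rfl⟩
  exact ⟨i0, h, (hg i0 hi0).trans h⟩

/-- exponent of a term of a minor -/
noncomputable def expo (c : Fin m → Fin m × W) (σ : Equiv.Perm (Fin m)) : ι →₀ ℕ :=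
  ∑ i, Finsupp.single (yv E (σ i) (c i)) 1

lemma expo_mem (c : Fin m → Fin m × W) (σ : Equiv.Perm (Fin m)) (x : ι) :
    x ∈ (expo E c σ).support ↔ ∃ i, yv E (σ i) (c i) = x := by
  simp [expo, Finsupp.finset_sum_apply, Finsupp.single_apply]

lemma good_unique (c c' : Fin m → Fin m × W) (σ σ' : Equiv.Perm (Fin m))
    (hg : ∀ i, ∃ i0, (c i0).1 = (c i).1 ∧ σ i0 = (c i).1) (h : expo E c σ = expo E c' σ') :
    ∀ i, ∃ i', c' i' = c i ∧ σ' i' = σ i := by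
  have hx : ∀ i, ∃ i', s(σ' i', (c' i').1) = s(σ i, (c i).1) ∧ (c' i').2 = (c i).2 := by
    intro i
    have : yv E (σ i) (c i) ∈ (expo E c σ).support := (expo_mem E c σ _).mpr ⟨i, rfl⟩
    rw [h, expo_mem] at this
    obtain ⟨i', hi'⟩ := this
    have := E.injective hi'
    rw [Prod.mk.injEq] at this
    exact ⟨i', this⟩
  intro i
  obtain ⟨i0, h1, h2⟩ := hg i
  obtain ⟨i0', h3, h4⟩ := hx i0
  obtain ⟨i', h5, h6⟩ := hx i
  rw [h1, h2, Sym2.eq_iff] at h3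
  rw [Sym2.eq_iff] at h5
  have h3' : σ' i0' = (c i).1 ∧ (c' i0').1 = (c i).1 := by tauto
  refine ⟨i', ?_⟩
  rcases h5 with ⟨ha, hb⟩ | ⟨ha, hb⟩
  · exact ⟨Prod.ext hb h6, ha⟩
  · have he : i' = i0' := σ'.injective (ha.trans h3'.1.symm)
    rw [← he] at h3'
    exact ⟨Prod.ext h3'.2 h6, ha.trans (h3'.2.symm.trans hb)⟩

lemma coeff_minor (c : Fin m → Fin m × W) (α : ι →₀ ℕ) : coeff α (minorP E c) =
    ∑ σ : Equiv.Perm (Fin m), if expo E c σ = α then ((Equiv.Perm.sign σ : ℤ) : ℂ) else 0 := by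
  rw [minorP_eq, coeff_sum]
  refine Finset.sum_congr rfl fun σ _ => ?_
  have : ∏ i, (X (yv E (σ i) (c i)) : MvPolynomial ι ℂ) = monomial (expo E c σ) 1 := by
    simp only [X, expo]
    rw [monomial_sum_one]
  rw [this, coeff_smul, coeff_monomial]
  simp

/-- chosen enumeration of an `m`-set of columns -/
noncomputable def enumJ {A : Type} (J : {J : Finset A // J.card = m}) (i : Fin m) : A :=
  ((Finset.equivFinOfCardEq J.2).symm i : J.1)

lemma enumJ_inj {A : Type} (J : {J : Finset A // J.card = m}) : Function.Injective (enumJ J) :=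
  fun _ _ h => (Finset.equivFinOfCardEq J.2).symm.injective (Subtype.ext h)

lemma enumJ_mem {A : Type} (J : {J : Finset A // J.card = m}) (i : Fin m) : enumJ J i ∈ J.1 :=
  ((Finset.equivFinOfCardEq J.2).symm i).2

lemma enumJ_surj {A : Type} (J : {J : Finset A // J.card = m}) (a : A) (ha : a ∈ J.1) :
    ∃ i, enumJ J i = a :=
  ⟨Finset.equivFinOfCardEq J.2 ⟨a, ha⟩, by simp [enumJ]⟩

lemma minor_indep : LinearIndependent ℂ
    (fun J : {J : Finset (Fin m × W) // J.card = m} => minorP E (enumJ J)) := by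
  rw [Fintype.linearIndependent_iff]
  intro g hg J
  obtain ⟨σ, hσ⟩ := exists_good (enumJ J)
  have h1 := congrArg (coeff (expo E (enumJ J) σ)) hg
  simp only [coeff_sum, coeff_smul, coeff_zero, smul_eq_mul] at h1
  rw [Finset.sum_eq_single J] at h1
  · rw [coeff_minor, Finset.sum_eq_single σ] at h1
    · simpa using h1
    · intro τ _ hτ
      rw [if_neg]
      intro h
      apply hτ
      ext1 i
      obtain ⟨i', h2, h3⟩ := good_unique E _ _ σ τ hσ h.symm i
      rw [enumJ_inj J h2] at h3
      exact h3
    · simp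
  · intro J' _ hJ
    rw [coeff_minor, Finset.sum_eq_zero, mul_zero]
    intro τ _
    rw [if_neg]
    intro h
    apply hJ
    refine Subtype.ext (Finset.eq_of_subset_of_card_le ?_ (by rw [J.2, J'.2])).symm
    intro a ha
    obtain ⟨i, rfl⟩ := enumJ_surj J a ha
    obtain ⟨i', h2, -⟩ := good_unique E _ _ σ τ hσ h.symm i
    rw [← h2]
    exact enumJ_mem J' i'
  · simp

lemma minor_span : Submodule.span ℂ (Set.range (minorP E)) = Submodule.span ℂ (Set.range
    (fun J : {J : Finset (Fin m × W) // J.card = m} => minorP E (enumJ J))) := by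
  refine le_antisymm ?_ (Submodule.span_mono ?_)
  · rw [Submodule.span_le]
    rintro _ ⟨c, rfl⟩
    by_cases hc : Function.Injective c
    · let J : {J : Finset (Fin m × W) // J.card = m} :=
        ⟨Finset.univ.image c, by rw [Finset.card_image_of_injective _ hc]; simp⟩
      have hs : ∀ i, ∃ j, enumJ J j = c i := fun i => enumJ_surj J _ (by simp [J])
      choose t ht using hs
      have hti : Function.Injective t := by
        intro a b hab
        apply hc
        rw [← ht, ← ht, hab]
      let τ : Equiv.Perm (Fin m) := Equiv.ofBijective t (Finite.injective_iff_bijective.mp hti)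
      have e : minorP E c = ((Equiv.Perm.sign τ : ℤ) : MvPolynomial ι ℂ) * minorP E (enumJ J) := by
        rw [minorP, minorP, ← Matrix.det_permute' τ]
        congr 1
        ext1 i j
        simp [τ, ht]
      rw [e, ← zsmul_eq_mul]
      exact zsmul_mem (Submodule.subset_span (Set.mem_range_self J)) _
    · have : minorP E c = 0 := by
        simp only [Function.Injective, not_forall] at hc
        obtain ⟨a, b, h1, h2⟩ := hc
        exact Matrix.det_zero_of_column_eq h2 (fun i => by simp [h1])
      rw [this]
      exact Submodule.zero_mem _
  · rintro _ ⟨J, rfl⟩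
    exact ⟨_, rfl⟩

lemma part_iii [Nonempty (Fin m × W)] :
    Module.finrank ℂ ↥(Submodule.restrictScalars ℂ (vI E) ⊓ homogeneousSubmodule ι ℂ m) =
      Nat.choose (m * Fintype.card W) m := by
  rw [deg_m_eq, minor_span, finrank_span_eq_card (minor_indep E), Fintype.card_finset_len]
  simp

end Main

section Transfer

/-- the index set as a product of symmetric squares -/
def permE (m n : ℕ) : Sym2 (Fin m) × Sym2 (Fin n) ≃ PermIdx m n :=
  (Equiv.prodCongr Sym2.sortEquiv Sym2.sortEquiv).trans
    { toFun := fun p => ⟨(p.1.1, p.2.1), p.1.2, p.2.2⟩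
      invFun := fun w => (⟨w.1.1, w.2.1⟩, ⟨w.1.2, w.2.2⟩)
      left_inv := fun _ => rfl
      right_inv := fun _ => rfl }

lemma permE_symm (m n : ℕ) (w : PermIdx m n) :
    (permE m n).symm w = (s(w.1.1.1, w.1.1.2), s(w.1.2.1, w.1.2.2)) := rfl

lemma permE_val (m n : ℕ) (i k : Fin m) (j l : Fin n)
    (T : Fin m → Fin m → Fin n → Fin n → ℂ)
    (hT : ∀ i i' j j', T i i' j j' = T i' i j j' ∧ T i i' j j' = T i i' j' j) :
    T (permE m n (s(i, k), s(j, l))).1.1.1 (permE m n (s(i, k), s(j, l))).1.1.2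
      (permE m n (s(i, k), s(j, l))).1.2.1 (permE m n (s(i, k), s(j, l))).1.2.2 = T i k j l := by
  have h := permE_symm m n (permE m n (s(i, k), s(j, l)))
  rw [Equiv.symm_apply_apply, Prod.mk.injEq, Sym2.eq_iff, Sym2.eq_iff] at h
  rcases h with ⟨⟨h1, h2⟩ | ⟨h1, h2⟩, ⟨h3, h4⟩ | ⟨h3, h4⟩⟩
  · rw [← h1, ← h2, ← h3, ← h4]
  · rw [← h1, ← h2, ← h3, ← h4, (hT i k l j).2]
  · rw [← h1, ← h2, ← h3, ← h4, (hT k i j l).1]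
  · rw [← h1, ← h2, ← h3, ← h4, (hT k i l j).1, (hT i k l j).2]

lemma vanishing_eq (m n : ℕ) : _root_.vanishingIdeal m n = vI (permE m n) := by
  ext f
  unfold _root_.vanishingIdeal
  simp only [Ideal.mem_iInf, RingHom.mem_ker, mem_vI]
  constructor
  · rintro h t ⟨v, hv, hvt⟩
    have := h (fun i k j l => t (permE m n (s(i, k), s(j, l)))) ⟨fun i k j l => ⟨by
      beta_reduce; rw [Sym2.eq_swap (a := i)], by beta_reduce; rw [Sym2.eq_swap (a := j)]⟩, v, hv, fun k j l => hvt k s(j, l)⟩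
    have e : t = fun w : PermIdx m n =>
        t (permE m n (s(w.1.1.1, w.1.1.2), s(w.1.2.1, w.1.2.2))) :=
      funext fun w => (congrArg t ((permE m n).apply_symm_apply w)).symm
    rw [e]
    exact this
  · rintro h T ⟨hT, v, hv, hvT⟩
    refine h _ ⟨v, hv, fun k w => ?_⟩
    induction w using Sym2.ind with
    | _ j l =>
      rw [← hvT k j l]
      refine Finset.sum_congr rfl fun i _ => ?_
      exact congrArg (v i * ·) (permE_val m n i k j l T hT)

end Transfer

/-- The vanishing ideal of the subspace variety: (i) contains no nonzero
homogeneous polynomial of degree `< m`; (ii) is generated by its homogeneous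
elements of degree `m`; (iii) its degree-`m` component has dimension
`C(m·n(n+1)/2, m)`. -/
theorem subspace_variety_equations (m n : ℕ) (hm : 1 ≤ m) (hn : 1 ≤ n) :
    (∀ f ∈ vanishingIdeal m n, ∀ d < m, f.IsHomogeneous d → f = 0) ∧
    vanishingIdeal m n =
      Ideal.span {f | f ∈ vanishingIdeal m n ∧ f.IsHomogeneous m} ∧
    Module.finrank ℂ
      ↥(Submodule.restrictScalars ℂ (vanishingIdeal m n) ⊓
        homogeneousSubmodule (PermIdx m n) ℂ m) =
      Nat.choose (m * (n * (n + 1) / 2)) m := by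
  classical
  have : Nonempty (Fin m × Sym2 (Fin n)) := ⟨(⟨0, hm⟩, s(⟨0, hn⟩, ⟨0, hn⟩))⟩
  let _ : Fintype (PermIdx m n) := Fintype.ofEquiv _ (permE m n)
  rw [vanishing_eq]
  refine ⟨fun f hf d hd h => part_i (permE m n) f hf d hd h, part_ii (permE m n), ?_⟩
  rw [part_iii (permE m n), Sym2.card, Fintype.card_fin, Nat.choose_two_right, Nat.add_sub_cancel,
    mul_comm (n + 1)]
end

section
/- Fix an integer n ≥ 1. If the ideal of 2×2 minors of the generic (n+2)×n matrix is of fiber type, then for every m ≥ n the ideal of 2×2 minors of the generic m×n matrix is of fiber type. -/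
open MvPolynomial

/-- Index set for the 2×2 minors of a generic `m × n` matrix:
quadruples `((i,i'),(j,j'))` with `i < i'` and `j < j'`. -/
def MinorIdx (m n : ℕ) : Type :=
  {w : (Fin m × Fin m) × (Fin n × Fin n) // w.1.1 < w.1.2 ∧ w.2.1 < w.2.2}

/-- The 2×2 minor `Δ_{(i,i'),(j,j')} = x_{i,j} x_{i',j'} - x_{i,j'} x_{i',j}`. -/
noncomputable def minorΔ {m n : ℕ} (w : MinorIdx m n) : MvPolynomial (Fin m × Fin n) ℂ :=
  X (w.1.1.1, w.1.2.1) * X (w.1.1.2, w.1.2.2) - X (w.1.1.1, w.1.2.2) * X (w.1.1.2, w.1.2.1)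

/-- The `S`-algebra map `Π : T = S[y_w] → S[t]` with `Π(y_w) = t·Δ_w`. -/
noncomputable def Pihom (m n : ℕ) :
    MvPolynomial (MinorIdx m n) (MvPolynomial (Fin m × Fin n) ℂ) →ₐ[MvPolynomial (Fin m × Fin n) ℂ]
      Polynomial (MvPolynomial (Fin m × Fin n) ℂ) :=
  aeval fun w => Polynomial.C (minorΔ w) * Polynomial.X

/-- The ideal of 2×2 minors of the generic `m × n` matrix is of *fiber type* if the
defining ideal `𝒥 = ker Π` of the Rees algebra is generated by `𝒥 ∩ ℂ[y_w : w]`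
together with the elements of `𝒥` homogeneous of degree 1 in the `y_w`. -/
def FiberType (m n : ℕ) : Prop :=
  RingHom.ker (Pihom m n) =
    Ideal.span
      ({f | f ∈ RingHom.ker (Pihom m n) ∧
          f ∈ Set.range (MvPolynomial.map
            (algebraMap ℂ (MvPolynomial (Fin m × Fin n) ℂ))
              (σ := MinorIdx m n))} ∪
        {f | f ∈ RingHom.ker (Pihom m n) ∧ f.IsHomogeneous 1})


set_option linter.unusedSectionVars false
set_option linter.unusedSimpArgs false

section Fischer
variable {σ τ : Type} [Fintype σ] [Fintype τ]

/-- Linear substitution attached to a matrix. -/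
noncomputable def linSub (M : Matrix τ σ ℂ) : MvPolynomial σ ℂ →ₐ[ℂ] MvPolynomial τ ℂ :=
  aeval fun z => ∑ w, M w z • X w

theorem linSub_X (M : Matrix τ σ ℂ) (z : σ) :
    linSub M (X z) = ∑ w, M w z • X w := by simp [linSub]

theorem linSub_C (M : Matrix τ σ ℂ) (c : ℂ) :
    linSub M (C c) = C c := by simp [linSub, algebraMap_eq]

theorem pderiv_linSub (M : Matrix τ σ ℂ) (f : MvPolynomial σ ℂ) (w : τ) :
    pderiv w (linSub M f) = ∑ z, M w z • linSub M (pderiv z f) := by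
  classical
  induction f using MvPolynomial.induction_on with
  | C a => simp [linSub_C]
  | add p q hp hq => simp [hp, hq, Finset.sum_add_distrib]
  | mul_X p i hp =>
    have h1 : pderiv w (linSub M (X i)) = C (M w i) := by
      rw [linSub_X]
      simp [pderiv_X, Pi.single_apply, smul_eq_C_mul]
    rw [map_mul, pderiv_mul, hp, h1]
    simp only [pderiv_mul, map_add, map_mul, smul_add, Finset.sum_add_distrib, Finset.sum_mul,
      smul_mul_assoc]
    congr 1
    simp [pderiv_X, Pi.single_apply, smul_eq_C_mul, apply_ite, mul_comm]

theorem linSub_totalDegree (M : Matrix τ σ ℂ) (f : MvPolynomial σ ℂ) :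
    (linSub M f).totalDegree ≤ f.totalDegree := by
  classical
  conv_lhs => rw [f.as_sum]
  rw [map_sum]
  refine totalDegree_finsetSum_le ?_
  intro α hα
  have hα' := le_totalDegree hα
  refine le_trans ?_ hα'
  rw [linSub, aeval_monomial]
  refine (totalDegree_mul _ _).trans ?_
  rw [algebraMap_eq, totalDegree_C, zero_add]
  refine (totalDegree_finsetProd _ _).trans ?_
  refine Finset.sum_le_sum fun i _ => ?_
  refine (totalDegree_pow _ _).trans ?_
  have : (∑ w, M w i • (X w : MvPolynomial τ ℂ)).totalDegree ≤ 1 := by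
    refine totalDegree_finsetSum_le fun w _ => ?_
    exact (totalDegree_smul_le _ _).trans (by simp)
  simpa using Nat.mul_le_mul_left (α i) this

/-- Multi-factorial. -/
def mfac (α : σ →₀ ℕ) : ℕ := ∏ z, (α z).factorial

theorem mfac_pos (α : σ →₀ ℕ) : 0 < mfac α := Finset.prod_pos fun _ _ => Nat.factorial_pos _

theorem mfac_add (α : σ →₀ ℕ) (z : σ) :
    mfac (α + Finsupp.single z 1) = (α z + 1) * mfac α := by
  classical
  unfold mfac
  rw [← Finset.mul_prod_erase _ _ (Finset.mem_univ z),
    ← Finset.mul_prod_erase _ (fun z => (α z).factorial) (Finset.mem_univ z), ← mul_assoc]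
  congr 1
  · simp [Nat.factorial_succ]
  · refine Finset.prod_congr rfl fun x hx => ?_
    have : z ≠ x := (Finset.ne_of_mem_erase hx).symm
    simp [Finsupp.single_apply, this]

/-- The Fischer inner product. -/
noncomputable def fis (f g : MvPolynomial σ ℂ) : ℂ :=
  ∑ α ∈ f.support, (mfac α : ℂ) * ((starRingEnd ℂ) (coeff α f) * coeff α g)

theorem fis_eq (f g : MvPolynomial σ ℂ) (s : Finset (σ →₀ ℕ)) (h : f.support ⊆ s) :
    fis f g = ∑ α ∈ s, (mfac α : ℂ) * ((starRingEnd ℂ) (coeff α f) * coeff α g) := by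
  refine Finset.sum_subset h fun α _ hα => ?_
  simp [notMem_support_iff.mp hα]

theorem fis_add_right (f g g' : MvPolynomial σ ℂ) : fis f (g + g') = fis f g + fis f g' := by
  simp [fis, mul_add, Finset.sum_add_distrib]

theorem fis_smul_right (f g : MvPolynomial σ ℂ) (c : ℂ) : fis f (c • g) = c * fis f g := by
  simp only [fis, coeff_smul, smul_eq_mul, Finset.mul_sum]
  exact Finset.sum_congr rfl fun _ _ => by ring

theorem fis_conj (f g : MvPolynomial σ ℂ) : (starRingEnd ℂ) (fis g f) = fis f g := by
  classical
  rw [fis_eq f g (f.support ∪ g.support) Finset.subset_union_left,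
    fis_eq g f (f.support ∪ g.support) Finset.subset_union_right, map_sum]
  exact Finset.sum_congr rfl fun _ _ => by
    simp only [map_mul, Complex.conj_conj, map_natCast]; ring

theorem fis_add_left (f f' g : MvPolynomial σ ℂ) : fis (f + f') g = fis f g + fis f' g := by
  rw [← fis_conj, fis_add_right, map_add, fis_conj, fis_conj]

theorem fis_smul_left (f g : MvPolynomial σ ℂ) (c : ℂ) :
    fis (c • f) g = (starRingEnd ℂ) c * fis f g := by
  rw [← fis_conj, fis_smul_right, map_mul, fis_conj]

theorem fis_self (f : MvPolynomial σ ℂ) :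
    fis f f = ((∑ α ∈ f.support, (mfac α : ℝ) * Complex.normSq (coeff α f) : ℝ) : ℂ) := by
  simp only [fis, Complex.ofReal_sum]
  refine Finset.sum_congr rfl fun α _ => ?_
  rw [← Complex.normSq_eq_conj_mul_self]; simp

theorem fis_self_eq_zero (f : MvPolynomial σ ℂ) (h : fis f f = 0) : f = 0 := by
  rw [fis_self, Complex.ofReal_eq_zero, Finset.sum_eq_zero_iff_of_nonneg] at h
  · by_contra hf
    obtain ⟨α, hα⟩ := Finset.nonempty_iff_ne_empty.mpr (mt support_eq_empty.mp hf)
    have := h α hα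
    have h2 := mfac_pos α
    simp only [mul_eq_zero, Nat.cast_eq_zero, map_eq_zero] at this
    rcases this with h3 | h3
    · omega
    · exact (mem_support_iff.mp hα) h3
  · intro α _
    exact mul_nonneg (Nat.cast_nonneg _) (Complex.normSq_nonneg _)

theorem fis_monomial (α : σ →₀ ℕ) (c : ℂ) (g : MvPolynomial σ ℂ) :
    fis (monomial α c) g = (mfac α : ℂ) * ((starRingEnd ℂ) c * coeff α g) := by
  classical
  rw [fis_eq _ _ {α} support_monomial_subset]
  simp

theorem fis_sum_left {ι : Type*} (s : Finset ι) (f : ι → MvPolynomial σ ℂ) (g : MvPolynomial σ ℂ) :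
    fis (∑ i ∈ s, f i) g = ∑ i ∈ s, fis (f i) g := by
  classical
  induction s using Finset.induction_on with
  | empty => simp [fis]
  | insert a s ha ih => simp [ha, ih, fis_add_left]

theorem fis_sum_right {ι : Type*} (s : Finset ι) (f : ι → MvPolynomial σ ℂ)
    (g : MvPolynomial σ ℂ) :
    fis g (∑ i ∈ s, f i) = ∑ i ∈ s, fis g (f i) := by
  classical
  induction s using Finset.induction_on with
  | empty => simp [fis]
  | insert a s ha ih => simp [ha, ih, fis_add_right]

theorem fis_mul_X (f g : MvPolynomial σ ℂ) (z : σ) : fis (f * X z) g = fis f (pderiv z g) := by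
  induction f using MvPolynomial.monomial_add_induction_on with
  | C a => 
    rw [C_apply, X, monomial_mul, fis_monomial, fis_monomial, mfac_add, coeff_pderiv]
    simp
  | monomial_add α a f _ _ ih =>
    rw [add_mul, fis_add_left, fis_add_left, ih, X, monomial_mul, fis_monomial, fis_monomial,
      mfac_add, coeff_pderiv]
    push_cast; simp; ring

theorem coeff_zero_linSub (M : Matrix τ σ ℂ) (f : MvPolynomial σ ℂ) :
    coeff 0 (linSub M f) = coeff 0 f := by
  rw [← constantCoeff_eq]
  have : (constantCoeff.comp (linSub M).toRingHom) = (constantCoeff : MvPolynomial σ ℂ →+* ℂ) := by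
    apply MvPolynomial.ringHom_ext
    · intro r; simp [linSub_C]
    · intro i; simp [linSub_X, constantCoeff_smul]
  exact congrArg (fun φ => φ f) this

theorem fis_linSub (M : Matrix τ σ ℂ) (f : MvPolynomial σ ℂ) (g : MvPolynomial τ ℂ) :
    fis (linSub M f) g = fis f (linSub M.conjTranspose g) := by
  induction f using MvPolynomial.induction_on generalizing g with
  | C a =>
    rw [linSub_C, C_apply, C_apply, fis_monomial, fis_monomial, coeff_zero_linSub]
    simp [mfac]
  | add p q hp hq => simp [fis_add_left, hp, hq]
  | mul_X p i hp =>
    rw [map_mul, linSub_X, fis_mul_X, pderiv_linSub, Finset.mul_sum, fis_sum_left, fis_sum_right]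
    refine Finset.sum_congr rfl fun w _ => ?_
    rw [mul_smul_comm, fis_smul_left, fis_mul_X, hp, fis_smul_right]
    rfl

/-- The inner product space core. -/
noncomputable def fisCore : InnerProductSpace.Core ℂ (MvPolynomial σ ℂ) where
  inner := fis
  conj_inner_symm := fun x y => fis_conj x y
  re_inner_nonneg := fun x => by
    change 0 ≤ RCLike.re (fis x x)
    rw [fis_self]
    simp only [RCLike.re_eq_complex_re, Complex.ofReal_re]
    exact Finset.sum_nonneg fun α _ => mul_nonneg (Nat.cast_nonneg _) (Complex.normSq_nonneg _)
  add_left := fis_add_left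
  smul_left := fis_smul_left
  definite := fis_self_eq_zero

theorem fis_decomp (N : Submodule ℂ (MvPolynomial σ ℂ)) [FiniteDimensional ℂ N]
    (f : MvPolynomial σ ℂ) : ∃ p ∈ N, ∃ q, (∀ g ∈ N, fis g q = 0) ∧ f = p + q := by
  let c : InnerProductSpace.Core ℂ (MvPolynomial σ ℂ) := fisCore
  let : NormedAddCommGroup (MvPolynomial σ ℂ) := c.toNormedAddCommGroup
  let : InnerProductSpace ℂ (MvPolynomial σ ℂ) := InnerProductSpace.ofCore c.toCore
  obtain ⟨p, hp, q, hq, h⟩ := N.exists_add_mem_mem_orthogonal f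
  exact ⟨p, hp, q, fun g hg => (Submodule.mem_orthogonal _ _).mp hq g hg, h⟩

/-- Euler: `D f - E f` has smaller degree. -/
theorem euler_totalDegree (f : MvPolynomial σ ℂ) (D : ℕ) (h : f.totalDegree ≤ D + 1) :
    (((D + 1 : ℕ) : ℂ) • f - ∑ z, pderiv z f * X z).totalDegree ≤ D := by
  classical
  have key : ∀ g : MvPolynomial σ ℂ, ∀ α, coeff α (∑ z, pderiv z g * X z)
      = ((α.degree : ℕ) : ℂ) * coeff α g := by
    intro g α
    rw [coeff_sum]
    rw [Finsupp.degree_eq_sum]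
    push_cast
    rw [Finset.sum_mul]
    refine Finset.sum_congr rfl fun z _ => ?_
    rw [coeff_mul_X']
    split_ifs with hz
    · rw [coeff_pderiv]
      have h1 : 1 ≤ α z := Nat.one_le_iff_ne_zero.mpr (Finsupp.mem_support_iff.mp hz)
      have h2 : α - Finsupp.single z 1 + Finsupp.single z 1 = α :=
        tsub_add_cancel_of_le (by simpa using h1)
      rw [h2]
      simp [Nat.cast_sub h1, mul_comm]
    · simp [Finsupp.notMem_support_iff.mp hz]
  refine Finset.sup_le fun α hα => ?_
  by_contra hcon
  apply mem_support_iff.mp hα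
  rw [coeff_sub, key, coeff_smul, smul_eq_mul]
  by_cases hc : coeff α f = 0
  · simp [hc]
  · have h1 := (le_totalDegree (mem_support_iff.mpr hc)).trans h
    have h2 : α.degree = α.sum fun _ e => e := rfl
    have : α.degree = D + 1 := by omega
    rw [this]; ring

end Fischer

section Rees

noncomputable instance instFintypeMinorIdx (m n : ℕ) : Fintype (MinorIdx m n) :=
  inferInstanceAs
    (Fintype {w : (Fin m × Fin m) × (Fin n × Fin n) // w.1.1 < w.1.2 ∧ w.2.1 < w.2.2})

/-- All variables of `T`. -/
abbrev RVar (m n : ℕ) : Type := MinorIdx m n ⊕ (Fin m × Fin n)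

/-- Action of a matrix on the `x` variables. -/
def xMat (n : ℕ) {a b : ℕ} (A : Matrix (Fin b) (Fin a) ℂ) :
    Matrix (Fin b × Fin n) (Fin a × Fin n) ℂ :=
  fun p q => if p.2 = q.2 then A p.1 q.1 else 0

/-- Action of a matrix on the `y` variables. -/
def yMat (n : ℕ) {a b : ℕ} (A : Matrix (Fin b) (Fin a) ℂ) :
    Matrix (MinorIdx b n) (MinorIdx a n) ℂ :=
  fun w v => if w.1.2 = v.1.2 then
    A w.1.1.1 v.1.1.1 * A w.1.1.2 v.1.1.2 - A w.1.1.1 v.1.1.2 * A w.1.1.2 v.1.1.1 else 0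

/-- Action of a matrix on all variables. -/
def bigMat (n : ℕ) {a b : ℕ} (A : Matrix (Fin b) (Fin a) ℂ) :
    Matrix (RVar b n) (RVar a n) ℂ := Matrix.fromBlocks (yMat n A) 0 0 (xMat n A)

theorem bigMat_conjTranspose (n : ℕ) {a b : ℕ} (A : Matrix (Fin b) (Fin a) ℂ) :
    (bigMat n A).conjTranspose = bigMat n A.conjTranspose := by
  rw [bigMat, Matrix.fromBlocks_conjTranspose, bigMat]
  congr 1
  · ext w v
    simp only [yMat, Matrix.conjTranspose_apply, eq_comm (a := w.1.2)]
    split_ifs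
    · simp; ring
    · simp
  · simp
  · simp
  · ext w v
    simp only [xMat, Matrix.conjTranspose_apply, eq_comm (a := w.2)]
    split_ifs <;> simp

/-- The map `Π` on the flattened polynomial ring. -/
noncomputable def flatPi (m n : ℕ) : MvPolynomial (RVar m n) ℂ →ₐ[ℂ]
    Polynomial (MvPolynomial (Fin m × Fin n) ℂ) :=
  ((Pihom m n).restrictScalars ℂ).comp
    (sumAlgEquiv ℂ (MinorIdx m n) (Fin m × Fin n)).toAlgHom

theorem flatPi_apply (m n : ℕ) (f : MvPolynomial (RVar m n) ℂ) :
    flatPi m n f = Pihom m n (sumAlgEquiv ℂ (MinorIdx m n) (Fin m × Fin n) f) := rfl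

theorem flatPi_inl (m n : ℕ) (w : MinorIdx m n) :
    flatPi m n (X (Sum.inl w)) = Polynomial.C (minorΔ w) * Polynomial.X := by
  rw [flatPi_apply, sumAlgEquiv_X_inl]; simp [Pihom]

theorem flatPi_inr (m n : ℕ) (p : Fin m × Fin n) :
    flatPi m n (X (Sum.inr p)) = Polynomial.C (X p) := by
  rw [flatPi_apply, sumAlgEquiv_X_inr, Pihom, aeval_C]; rfl

theorem sum_pairs {M : Type*} [AddCommMonoid M] {b : ℕ} (G : Fin b × Fin b → M)
    (hG : ∀ l, G (l, l) = 0) :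
    ∑ p, G p = ∑ p with p.1 < p.2, (G p + G p.swap) := by
  rw [Finset.sum_add_distrib]
  have h2 : ∑ p : Fin b × Fin b with p.1 < p.2, G p.swap
      = ∑ p : Fin b × Fin b with p.2 < p.1, G p := by
    rw [Finset.sum_filter, Finset.sum_filter]
    exact Fintype.sum_equiv (Equiv.prodComm _ _) _ _ (fun p => rfl)
  rw [h2, Finset.sum_filter, Finset.sum_filter, ← Finset.sum_add_distrib]
  refine Finset.sum_congr rfl fun p _ => ?_
  obtain ⟨l, l'⟩ := p
  rcases lt_trichotomy l l' with h | h | h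
  · simp [h, h.not_gt]
  · subst h; simp [hG]
  · simp [h, h.not_gt]

theorem sum_minorIdx {M : Type*} [AddCommMonoid M] {b n : ℕ} (c : Fin n × Fin n) (hc : c.1 < c.2)
    (F : Fin b × Fin b → M) :
    ∑ w : MinorIdx b n, (if w.1.2 = c then F w.1.1 else 0) = ∑ p with p.1 < p.2, F p := by
  rw [← Finset.sum_filter]
  refine Finset.sum_bij (fun w _ => w.1.1) ?_ ?_ ?_ ?_
  · intro w _; simpa using w.2.1
  · intro w hw v hv h
    simp only [Finset.mem_filter, Finset.mem_univ, true_and] at hw hv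
    exact Subtype.ext (Prod.ext h (hw.trans hv.symm))
  · intro p hp
    simp only [Finset.mem_filter, Finset.mem_univ, true_and] at hp
    exact ⟨⟨(p, c), hp, hc⟩, Finset.mem_filter.mpr ⟨Finset.mem_univ _, rfl⟩, rfl⟩
  · intros; rfl

theorem linSub_xMat_X (n : ℕ) {a b : ℕ} (A : Matrix (Fin b) (Fin a) ℂ) (i : Fin a) (j : Fin n) :
    linSub (xMat n A) (X (i, j)) = ∑ l, C (A l i) * X (l, j) := by
  rw [linSub_X, Fintype.sum_prod_type]
  refine Finset.sum_congr rfl fun l _ => ?_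
  simp [xMat, smul_eq_C_mul, apply_ite C, ite_mul]

/-- The Cauchy-Binet formula for 2×2 minors. -/
theorem linSub_minor (n : ℕ) {a b : ℕ} (A : Matrix (Fin b) (Fin a) ℂ) (v : MinorIdx a n) :
    linSub (xMat n A) (minorΔ v) = ∑ w, yMat n A w v • minorΔ w := by
  obtain ⟨⟨⟨i, i'⟩, ⟨j, j'⟩⟩, hi, hj⟩ := v
  have h1 : ∀ w : MinorIdx b n, yMat n A w ⟨((i, i'), (j, j')), hi, hj⟩ • minorΔ w =
      if w.1.2 = (j, j') then C (A w.1.1.1 i * A w.1.1.2 i' - A w.1.1.1 i' * A w.1.1.2 i) *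
        (X (w.1.1.1, j) * X (w.1.1.2, j') - X (w.1.1.1, j') * X (w.1.1.2, j)) else 0 := by
    intro w
    simp only [yMat, minorΔ]
    split_ifs with h
    · rw [h, smul_eq_C_mul]
    · simp
  rw [Finset.sum_congr rfl fun w _ => h1 w,
    sum_minorIdx (j, j') hj (fun p => C (A p.1 i * A p.2 i' - A p.1 i' * A p.2 i) *
        (X (p.1, j) * X (p.2, j') - X (p.1, j') * X (p.2, j)))]
  simp only [minorΔ, map_sub, map_mul, linSub_xMat_X]
  rw [Finset.sum_mul_sum, Finset.sum_mul_sum, ← Finset.sum_product', ← Finset.sum_product',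
    ← Finset.sum_sub_distrib, Finset.univ_product_univ, sum_pairs]
  · refine Finset.sum_congr rfl fun p _ => ?_
    simp only [Prod.fst_swap, Prod.snd_swap]
    ring
  · intro l; ring

theorem flatPi_linSub (n : ℕ) {a b : ℕ} (A : Matrix (Fin b) (Fin a) ℂ)
    (f : MvPolynomial (RVar a n) ℂ) :
    flatPi b n (linSub (bigMat n A) f) =
      Polynomial.mapAlgHom (linSub (xMat n A)) (flatPi a n f) := by
  have : (flatPi b n).comp (linSub (bigMat n A)) =
      (Polynomial.mapAlgHom (linSub (xMat n A))).comp (flatPi a n) := by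
    apply MvPolynomial.algHom_ext
    rintro (w | p)
    · simp only [AlgHom.comp_apply, linSub_X, Fintype.sum_sum_type, map_add, map_sum, map_smul,
        flatPi_inl, flatPi_inr, bigMat, Matrix.fromBlocks_apply₁₁, Matrix.fromBlocks_apply₂₁,
        Matrix.zero_apply, zero_smul, Finset.sum_const_zero, add_zero]
      simp only [Polynomial.coe_mapAlgHom, Polynomial.map_mul, Polynomial.map_C,
        Polynomial.map_X, RingHom.coe_coe, linSub_minor, map_sum, Finset.sum_mul]
      refine Finset.sum_congr rfl fun x _ => ?_
      rw [← Polynomial.smul_C, smul_mul_assoc]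
    · simp only [AlgHom.comp_apply, linSub_X, Fintype.sum_sum_type, map_add, map_sum, map_smul,
        flatPi_inl, flatPi_inr, bigMat, Matrix.fromBlocks_apply₁₂, Matrix.fromBlocks_apply₂₂,
        Matrix.zero_apply, zero_smul, Finset.sum_const_zero, zero_add]
      simp only [Polynomial.coe_mapAlgHom, Polynomial.map_C, RingHom.coe_coe, linSub_X, map_sum]
      refine Finset.sum_congr rfl fun x _ => ?_
      rw [← Polynomial.smul_C]
  exact congrArg (fun φ => φ f) this

/-- The ideal generated by the fiber and linear relations. -/
noncomputable def fibIdeal (m n : ℕ) :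
    Ideal (MvPolynomial (MinorIdx m n) (MvPolynomial (Fin m × Fin n) ℂ)) :=
    Ideal.span
      ({f | f ∈ RingHom.ker (Pihom m n) ∧
          f ∈ Set.range (MvPolynomial.map
            (algebraMap ℂ (MvPolynomial (Fin m × Fin n) ℂ))
              (σ := MinorIdx m n))} ∪
        {f | f ∈ RingHom.ker (Pihom m n) ∧ f.IsHomogeneous 1})

/-- The action on the unflattened ring. -/
noncomputable def actT (n : ℕ) {a b : ℕ} (A : Matrix (Fin b) (Fin a) ℂ) :
    MvPolynomial (MinorIdx a n) (MvPolynomial (Fin a × Fin n) ℂ) →ₐ[ℂ]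
    MvPolynomial (MinorIdx b n) (MvPolynomial (Fin b × Fin n) ℂ) :=
  ((sumAlgEquiv ℂ (MinorIdx b n) (Fin b × Fin n)).toAlgHom.comp (linSub (bigMat n A))).comp
    (sumAlgEquiv ℂ (MinorIdx a n) (Fin a × Fin n)).symm.toAlgHom

theorem actT_apply (n : ℕ) {a b : ℕ} (A : Matrix (Fin b) (Fin a) ℂ)
    (f : MvPolynomial (MinorIdx a n) (MvPolynomial (Fin a × Fin n) ℂ)) :
    actT n A f = sumAlgEquiv ℂ _ _ (linSub (bigMat n A) ((sumAlgEquiv ℂ _ _).symm f)) := rfl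

theorem actT_X (n : ℕ) {a b : ℕ} (A : Matrix (Fin b) (Fin a) ℂ) (w : MinorIdx a n) :
    actT n A (X w) = ∑ v, yMat n A v w • X v := by
  rw [actT_apply, sumAlgEquiv_symm_X, linSub_X, Fintype.sum_sum_type]
  simp [bigMat, map_sum, map_smul]

theorem actT_C_X (n : ℕ) {a b : ℕ} (A : Matrix (Fin b) (Fin a) ℂ) (p : Fin a × Fin n) :
    actT n A (C (X p)) = C (linSub (xMat n A) (X p)) := by
  rw [actT_apply, sumAlgEquiv_symm_C_X, linSub_X, Fintype.sum_sum_type, linSub_X]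
  simp only [bigMat, Matrix.fromBlocks_apply₁₂, Matrix.fromBlocks_apply₂₂,
        Matrix.zero_apply, zero_smul, Finset.sum_const_zero, zero_add, map_sum, map_smul,
        sumAlgEquiv_X_inr]
  refine Finset.sum_congr rfl fun x _ => ?_
  exact (map_smul (IsScalarTower.toAlgHom ℂ (MvPolynomial (Fin b × Fin n) ℂ)
    (MvPolynomial (MinorIdx b n) (MvPolynomial (Fin b × Fin n) ℂ))) _ _).symm

theorem Pihom_actT (n : ℕ) {a b : ℕ} (A : Matrix (Fin b) (Fin a) ℂ)
    (f : MvPolynomial (MinorIdx a n) (MvPolynomial (Fin a × Fin n) ℂ)) (hf : Pihom a n f = 0) :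
    Pihom b n (actT n A f) = 0 := by
  rw [actT_apply, ← flatPi_apply, flatPi_linSub, flatPi_apply, AlgEquiv.apply_symm_apply, hf,
    map_zero]

theorem actT_eq_eval₂ (n : ℕ) {a b : ℕ} (A : Matrix (Fin b) (Fin a) ℂ)
    (f : MvPolynomial (MinorIdx a n) (MvPolynomial (Fin a × Fin n) ℂ)) :
    actT n A f = eval₂ ((C : MvPolynomial (Fin b × Fin n) ℂ →+* _).comp
      (linSub (xMat n A)).toRingHom) (fun w => ∑ v, yMat n A v w • X v) f := by
  have : (actT n A).toRingHom = eval₂Hom ((C : MvPolynomial (Fin b × Fin n) ℂ →+* _).comp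
      (linSub (xMat n A)).toRingHom) (fun w => ∑ v, yMat n A v w • X v) := by
    apply MvPolynomial.ringHom_ext'
    · apply MvPolynomial.ringHom_ext
      · intro r
        have : (C (C r) : MvPolynomial (MinorIdx a n) (MvPolynomial (Fin a × Fin n) ℂ)) =
          algebraMap ℂ _ r := rfl
        simp only [RingHom.comp_apply, coe_eval₂Hom, eval₂_C, AlgHom.toRingHom_eq_coe,
          RingHom.coe_coe, linSub_C]
        rw [this, AlgHom.commutes]
        rfl
      · intro p
        simp only [RingHom.comp_apply, coe_eval₂Hom, eval₂_C, AlgHom.toRingHom_eq_coe,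
          RingHom.coe_coe, actT_C_X]
    · intro w
      simp only [coe_eval₂Hom, eval₂_X, AlgHom.toRingHom_eq_coe, RingHom.coe_coe, actT_X]
  exact congrArg (fun φ => φ f) this

theorem actT_fibIdeal (n : ℕ) {a b : ℕ} (A : Matrix (Fin b) (Fin a) ℂ)
    (f : MvPolynomial (MinorIdx a n) (MvPolynomial (Fin a × Fin n) ℂ)) (hf : f ∈ fibIdeal a n) :
    actT n A f ∈ fibIdeal b n := by
  suffices h : fibIdeal a n ≤ (fibIdeal b n).comap (actT n A) from h hf
  rw [fibIdeal, Ideal.span_le]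
  rintro f (⟨hk, g, rfl⟩ | ⟨hk, hh⟩)
  · refine Ideal.subset_span (Or.inl ⟨Pihom_actT n A _ hk, linSub (yMat n A) g, ?_⟩)
    have : (mapAlgHom (Algebra.ofId ℂ (MvPolynomial (Fin b × Fin n) ℂ))).comp (linSub (yMat n A))
        = (actT n A).comp (mapAlgHom (Algebra.ofId ℂ (MvPolynomial (Fin a × Fin n) ℂ))) := by
      apply MvPolynomial.algHom_ext
      intro w
      simp only [AlgHom.comp_apply, linSub_X, map_sum, map_smul, mapAlgHom_apply, eval₂_X, map_X, actT_X]
    have h2 := congrArg (fun φ => φ g) this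
    exact h2
  · refine Ideal.subset_span (Or.inr ⟨Pihom_actT n A _ hk, ?_⟩)
    rw [actT_eq_eval₂]
    refine hh.eval₂ (n := 1) _ _ (fun r => isHomogeneous_C _ _) (fun w => ?_)
    refine IsHomogeneous.sum _ _ _ fun v _ => ?_
    have := (isHomogeneous_C (MinorIdx b n)
      (C (yMat n A v w) : MvPolynomial (Fin b × Fin n) ℂ)).mul (isHomogeneous_X _ v)
    rw [zero_add] at this
    convert this using 1
    rw [← algebraMap_smul (MvPolynomial (Fin b × Fin n) ℂ), smul_eq_C_mul]; rfl

end Rees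

section Main

/-- The substitution matrix used for evaluation. -/
def evMat {m n : ℕ} (x : Fin m × Fin n → ℂ) (i₀ i₁ : Fin m) : Matrix (Fin (n + 2)) (Fin m) ℂ :=
  fun l i => if h : l.1 < n then x (i, ⟨l.1, h⟩) else
    if l.1 = n then (if i = i₀ then 1 else 0) else (if i = i₁ then 1 else 0)

theorem eval_linSub_evMat {m n : ℕ} (x : Fin m × Fin n → ℂ) (i₀ i₁ : Fin m)
    (c : MvPolynomial (Fin m × Fin n) ℂ) :
    eval (fun p : Fin (n + 2) × Fin n => if p.1.1 = p.2.1 then (1 : ℂ) else 0)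
      (linSub (xMat n (evMat x i₀ i₁)) c) = eval x c := by
  set x₀ := (fun p : Fin (n + 2) × Fin n => if p.1.1 = p.2.1 then (1 : ℂ) else 0) with hx₀
  have : (aeval x₀ : _ →ₐ[ℂ] ℂ).comp (linSub (xMat n (evMat x i₀ i₁))) = aeval x := by
    apply MvPolynomial.algHom_ext
    rintro ⟨i, j⟩
    rw [AlgHom.comp_apply, linSub_xMat_X, map_sum,
      Finset.sum_eq_single (⟨j.1, by omega⟩ : Fin (n + 2))]
    · simp [evMat, hx₀]
    · intro l _ hl
      have : l.1 ≠ j.1 := fun h => hl (Fin.ext h)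
      simp [hx₀, this]
    · simp
  have h2 := congrArg (fun φ => φ c) this
  simpa [aeval_eq_eval] using h2

theorem pderiv_mem_ker {m n : ℕ} (q : MvPolynomial (RVar m n) ℂ)
    (hq : ∀ B : Matrix (Fin (n + 2)) (Fin m) ℂ, linSub (bigMat n B) q = 0) (z : RVar m n) :
    flatPi m n (pderiv z q) = 0 := by
  classical
  -- it suffices to find, for every point, a good index
  suffices h : ∀ x : Fin m × Fin n → ℂ, ∃ i₀ i₁, ∃ w : RVar (n + 2) n,
      ∀ z', bigMat n (evMat x i₀ i₁) w z' = if z' = z then 1 else 0 by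
    ext1 d
    rw [Polynomial.coeff_zero]
    apply MvPolynomial.funext
    intro x
    obtain ⟨i₀, i₁, w, hw⟩ := h x
    have h1 := pderiv_linSub (bigMat n (evMat x i₀ i₁)) q w
    rw [hq, map_zero] at h1
    simp only [hw, ite_smul, one_smul, zero_smul, Finset.sum_ite_eq', Finset.mem_univ,
      if_true] at h1
    have h2 := flatPi_linSub n (evMat x i₀ i₁) (pderiv z q)
    rw [← h1, map_zero] at h2
    have h3 := congrArg (fun p => Polynomial.coeff p d) h2
    simp only [Polynomial.coeff_zero, Polynomial.coe_mapAlgHom, Polynomial.coeff_map,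
      RingHom.coe_coe] at h3
    rw [← eval_linSub_evMat x i₀ i₁, ← h3, map_zero, map_zero]
  intro x
  rcases z with w | ⟨i, j⟩
  · obtain ⟨w₀, hw₀⟩ : ∃ w₀ : MinorIdx (n + 2) n,
        w₀.1 = ((⟨n, by omega⟩, ⟨n + 1, by omega⟩), w.1.2) :=
      ⟨⟨((⟨n, by omega⟩, ⟨n + 1, by omega⟩), w.1.2), by simp, w.2.2⟩, rfl⟩
    refine ⟨w.1.1.1, w.1.1.2, Sum.inl w₀, ?_⟩
    rintro (v | p)
    · have e : (Sum.inl v : RVar m n) = Sum.inl w ↔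
          (v.1.1.1 = w.1.1.1 ∧ v.1.1.2 = w.1.1.2) ∧ w.1.2 = v.1.2 := by
        rw [Sum.inl.injEq]
        refine Subtype.ext_iff.trans ?_
        rw [Prod.ext_iff, Prod.ext_iff, eq_comm (a := w.1.2)]
      have hv := v.2.1
      have hw := w.2.1
      simp only [e]
      simp only [bigMat, Matrix.fromBlocks_apply₁₁, yMat, evMat, hw₀]
      by_cases hjl : w.1.2 = v.1.2
      · simp only [hjl, if_true, and_true]
        simp only [lt_irrefl, dite_false, if_true, Nat.not_succ_le_self, Nat.succ_ne_self]
        generalize v.1.1.1 = k at *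
        generalize v.1.1.2 = k' at *
        generalize w.1.1.1 = i at *
        generalize w.1.1.2 = i' at *
        have : ¬ (k' = i ∧ k = i') := by
          rintro ⟨rfl, rfl⟩
          exact absurd hw hv.not_gt
        have h3 : ¬ (n + 1 < n) := by omega
        by_cases a1 : k = i <;> by_cases a2 : k' = i' <;> by_cases a3 : k' = i <;>
          by_cases a4 : k = i' <;> simp_all
      · simp [hjl]
    · simp [bigMat]
  · refine ⟨i, i, Sum.inr (⟨n, by omega⟩, j), ?_⟩
    rintro (v | ⟨k, l⟩)
    · simp [bigMat]
    · simp only [bigMat, Matrix.fromBlocks_apply₂₂, xMat, evMat, Sum.inr.injEq, Prod.mk.injEq,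
        lt_irrefl, dite_false, if_true]
      by_cases h1 : j = l <;> by_cases h2 : k = i <;> simp [h1, h2, eq_comm]

theorem ker_le_fibIdeal (m n : ℕ) (h : FiberType (n + 2) n) (D : ℕ) :
    ∀ f : MvPolynomial (RVar m n) ℂ, f.totalDegree ≤ D → flatPi m n f = 0 →
      sumAlgEquiv ℂ (MinorIdx m n) (Fin m × Fin n) f ∈ fibIdeal m n := by
  induction D with
  | zero =>
    intro f hD hf
    rw [totalDegree_eq_zero_iff_eq_C.mp (Nat.le_zero.mp hD)] at hf ⊢
    have h1 : flatPi m n (C (coeff 0 f)) = Polynomial.C (C (coeff 0 f)) :=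
      (flatPi m n).commutes _
    rw [h1, Polynomial.C_eq_zero, C_eq_zero] at hf
    simp [hf]
  | succ D ih =>
    intro f hD hf
    let N : Submodule ℂ (MvPolynomial (RVar m n) ℂ) := Submodule.span ℂ
      {p | ∃ A : Matrix (Fin m) (Fin (n + 2)) ℂ, ∃ g : MvPolynomial (RVar (n + 2) n) ℂ,
        flatPi (n + 2) n g = 0 ∧ g.totalDegree ≤ D + 1 ∧ p = linSub (bigMat n A) g}
    have hN1 : N ≤ restrictTotalDegree _ ℂ (D + 1) := by
      refine Submodule.span_le.mpr ?_
      rintro p ⟨A, g, _, hg, rfl⟩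
      exact (mem_restrictTotalDegree _ _ _).mpr ((linSub_totalDegree _ _).trans hg)
    have hN2 : N ≤ LinearMap.ker (flatPi m n).toLinearMap := by
      refine Submodule.span_le.mpr ?_
      rintro p ⟨A, g, hg, _, rfl⟩
      change flatPi m n _ = 0
      rw [flatPi_linSub, hg, map_zero]
    have hN3 : N ≤ ((fibIdeal m n).restrictScalars ℂ).comap
        (sumAlgEquiv ℂ (MinorIdx m n) (Fin m × Fin n)).toLinearMap := by
      refine Submodule.span_le.mpr ?_
      rintro p ⟨A, g, hg, _, rfl⟩
      change sumAlgEquiv ℂ _ _ _ ∈ fibIdeal m n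
      have h1 : sumAlgEquiv ℂ (MinorIdx (n + 2) n) (Fin (n + 2) × Fin n) g ∈
          fibIdeal (n + 2) n := by
        rw [fibIdeal, ← (show _ = _ from h), RingHom.mem_ker, ← flatPi_apply, hg]
      have h2 := actT_fibIdeal n A _ h1
      rwa [actT_apply, AlgEquiv.symm_apply_apply] at h2
    have : FiniteDimensional ℂ N := Submodule.finiteDimensional_of_le hN1
    obtain ⟨p, hp, q, hq, rfl⟩ := fis_decomp N f
    have hpk : flatPi m n p = 0 := LinearMap.mem_ker.mp (hN2 hp)
    have hqk : flatPi m n q = 0 := by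
      have h1 := map_add (flatPi m n) p q
      rw [hf, hpk, zero_add] at h1
      exact h1.symm
    have hqD : q.totalDegree ≤ D + 1 := by
      have h1 := (mem_restrictTotalDegree _ _ _).mpr hD
      have h2 := (Submodule.add_mem_iff_right _ (hN1 hp)).mp h1
      exact (mem_restrictTotalDegree _ _ _).mp h2
    have hz : ∀ B : Matrix (Fin (n + 2)) (Fin m) ℂ, linSub (bigMat n B) q = 0 := by
      intro B
      apply fis_self_eq_zero
      rw [← fis_conj, fis_linSub, bigMat_conjTranspose, fis_conj]
      apply hq
      refine Submodule.subset_span ⟨B.conjTranspose, _, ?_,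
        (linSub_totalDegree _ _).trans hqD, rfl⟩
      rw [flatPi_linSub, hqk, map_zero]
    have hd : ∀ z, flatPi m n (pderiv z q) = 0 := pderiv_mem_ker q hz
    have hdL : ∀ z, sumAlgEquiv ℂ (MinorIdx m n) (Fin m × Fin n) (pderiv z q) ∈
        fibIdeal m n := by
      intro z
      refine ih _ ?_ (hd z)
      refine Finset.sup_le fun α hα => ?_
      rw [mem_support_iff, coeff_pderiv] at hα
      have h1 := (le_totalDegree (mem_support_iff.mpr (left_ne_zero_of_mul hα))).trans hqD
      have h2 : (α + Finsupp.single z 1).degree = α.degree + 1 := by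
        rw [map_add, Finsupp.degree_single]
      have h3 : α.degree = α.sum fun _ e => e := rfl
      have h4 : (α + Finsupp.single z 1).degree
        = (α + Finsupp.single z 1).sum fun _ e => e := rfl
      omega
    have hE : sumAlgEquiv ℂ (MinorIdx m n) (Fin m × Fin n) (∑ z, pderiv z q * X z) ∈
        fibIdeal m n := by
      rw [map_sum]
      refine Ideal.sum_mem _ fun z _ => ?_
      rw [map_mul]
      exact Ideal.mul_mem_right _ _ (hdL z)
    have hR := ih _ (euler_totalDegree q D hqD) (by
      simp [map_sub, map_sum, map_mul, hd, hqk])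
    rw [map_sub] at hR
    have hS := (Submodule.sub_mem_iff_left _ hE).mp hR
    have hq' : sumAlgEquiv ℂ (MinorIdx m n) (Fin m × Fin n) q ∈ fibIdeal m n := by
      have h1 : q = ((D + 1 : ℕ) : ℂ)⁻¹ • (((D + 1 : ℕ) : ℂ) • q) := by
        rw [smul_smul, inv_mul_cancel₀ (Nat.cast_ne_zero.mpr (Nat.succ_ne_zero D)), one_smul]
      rw [h1, map_smul]
      exact ((fibIdeal m n).restrictScalars ℂ).smul_mem _ hS
    rw [map_add]
    exact Ideal.add_mem _ (hN3 hp) hq'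

end Main

/-- If the ideal of 2×2 minors of the generic `(n+2) × n` matrix is of fiber
type, then for every `m ≥ n` the ideal of 2×2 minors of the generic `m × n`
matrix is of fiber type. -/
theorem fiber_type_reduction (n : ℕ) (hn : 1 ≤ n) (h : FiberType (n + 2) n) :
    ∀ m, n ≤ m → FiberType m n := by

  intro m _
  refine le_antisymm ?_ ?_
  · intro f hf
    have h1 := ker_le_fibIdeal m n h _ ((sumAlgEquiv ℂ _ _).symm f) le_rfl (by
      rw [flatPi_apply, AlgEquiv.apply_symm_apply]; exact hf)
    rwa [AlgEquiv.apply_symm_apply] at h1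
  · rw [Ideal.span_le]
    rintro f (⟨hk, _⟩ | ⟨hk, _⟩) <;> exact hk
end
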